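/- Every (1/13)-dense partial latin square of order n having at most 5.7·10⁻⁷·n² filled cells has a completion to a latin square of order n. -/

import Mathlib

/-- A partial latin square of order `n`: each symbol occurs at most once in
each row and at most once in each column. -/
def IsPartialLatinSquare {n : ℕ} (P : Fin n → Fin n → Option (Fin n)) : Prop :=
  (∀ i j j' s, P i j = some s → P i j' = some s → j = j') ∧
  (∀ i i' j s, P i j = some s → P i' j = some s → i = i')

/-- `P` is `ε`-dense: every row, column, and symbol of `P` has at most `ε * n`
filled cells. -/
def IsEpsDense {n : ℕ} (ε : ℝ) (P : Fin n → Fin n → Option (Fin n)) : Prop :=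
  (∀ i, ((Finset.univ.filter fun j => (P i j).isSome).card : ℝ) ≤ ε * n) ∧
  (∀ j, ((Finset.univ.filter fun i => (P i j).isSome).card : ℝ) ≤ ε * n) ∧
  (∀ s, ((Finset.univ.filter fun p : Fin n × Fin n => P p.1 p.2 = some s).card : ℝ) ≤ ε * n)

/-- A latin square of order `n`: every row and every column contains each
symbol exactly once. -/
def IsLatinSquare {n : ℕ} (L : Fin n → Fin n → Fin n) : Prop :=
  (∀ i, Function.Bijective (L i)) ∧ (∀ j, Function.Bijective fun i => L i j)

/-- `L` completes `P`. -/
def Completes {n : ℕ} (L : Fin n → Fin n → Fin n)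
    (P : Fin n → Fin n → Option (Fin n)) : Prop :=
  ∀ i j s, P i j = some s → L i j = s

/-- The number of filled cells of a partial latin square. -/
def filledCells {n : ℕ} (P : Fin n → Fin n → Option (Fin n)) : ℕ :=
  (Finset.univ.filter fun p : Fin n × Fin n => P p.1 p.2 ≠ none).card


set_option linter.unusedSectionVars false
set_option linter.unusedDecidableInType false
set_option linter.unusedFintypeInType false

namespace PLS
open Finset

variable {V : Type*} [Fintype V] [DecidableEq V]

/-- A latin square viewed as a set of triples (row, column, symbol). -/
def Lat (L : Finset (V × V × V)) : Prop :=
  ∃ s c r : V → V → V, ∀ x y z, ((x, y, z) ∈ L ↔ s x y = z) ∧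
    ((x, y, z) ∈ L ↔ c x z = y) ∧ ((x, y, z) ∈ L ↔ r y z = x)

/-- Number of triples of `S` on the line of a given row / column / symbol. -/
def l1 (S : Finset (V × V × V)) (x : V) : ℕ := (S.filter (fun t => t.1 = x)).card
def l2 (S : Finset (V × V × V)) (x : V) : ℕ := (S.filter (fun t => t.2.1 = x)).card
def l3 (S : Finset (V × V × V)) (x : V) : ℕ := (S.filter (fun t => t.2.2 = x)).card

def Near (k : ℕ) (L L' : Finset (V × V × V)) : Prop :=
  (L' \ L).card ≤ 4 * k ∧ ∀ x, l1 (L' \ L) x ≤ 2 * k ∧ l2 (L' \ L) x ≤ 2 * k ∧ l3 (L' \ L) x ≤ 2 * k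

/-- `t` can be placed preserving `F`, by `k` intercalate switches. -/
def Pl (k : ℕ) (L F : Finset (V × V × V)) (t : V × V × V) : Prop :=
  ∃ L', Lat L' ∧ Near k L L' ∧ t ∈ L' ∧ F ⊆ L'

lemma l1_mono {S T : Finset (V × V × V)} (h : S ⊆ T) (x : V) : l1 S x ≤ l1 T x :=
  card_le_card (filter_subset_filter _ h)
lemma l2_mono {S T : Finset (V × V × V)} (h : S ⊆ T) (x : V) : l2 S x ≤ l2 T x :=
  card_le_card (filter_subset_filter _ h)
lemma l3_mono {S T : Finset (V × V × V)} (h : S ⊆ T) (x : V) : l3 S x ≤ l3 T x :=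
  card_le_card (filter_subset_filter _ h)
lemma l1_union (S T : Finset (V × V × V)) (x : V) : l1 (S ∪ T) x ≤ l1 S x + l1 T x := by
  unfold l1; rw [filter_union]; exact card_union_le _ _
lemma l2_union (S T : Finset (V × V × V)) (x : V) : l2 (S ∪ T) x ≤ l2 S x + l2 T x := by
  unfold l2; rw [filter_union]; exact card_union_le _ _
lemma l3_union (S T : Finset (V × V × V)) (x : V) : l3 (S ∪ T) x ≤ l3 S x + l3 T x := by
  unfold l3; rw [filter_union]; exact card_union_le _ _
lemma l1_card (S : Finset (V × V × V)) (x : V) : l1 S x ≤ S.card := card_filter_le _ _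
lemma l2_card (S : Finset (V × V × V)) (x : V) : l2 S x ≤ S.card := card_filter_le _ _
lemma l3_card (S : Finset (V × V × V)) (x : V) : l3 S x ≤ S.card := card_filter_le _ _

lemma Near.refl (L : Finset (V × V × V)) : Near 0 L L := by
  simp [Near, l1, l2, l3]

lemma Near.mono {a b : ℕ} {L L' : Finset (V × V × V)} (h : Near a L L') (hab : a ≤ b) :
    Near b L L' := by
  refine ⟨by have := h.1; omega, fun x => ?_⟩
  have := h.2 x
  omega

lemma Near.trans {a b : ℕ} {L L' L'' : Finset (V × V × V)} (h : Near a L L') (h' : Near b L' L'') :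
    Near (a + b) L L'' := by
  have hs : L'' \ L ⊆ (L' \ L) ∪ (L'' \ L') := by
    intro t; simp only [mem_union, mem_sdiff]; tauto
  refine ⟨?_, fun x => ?_⟩
  · have := card_le_card hs
    have := card_union_le (L' \ L) (L'' \ L')
    have := h.1
    have := h'.1
    omega
  · have := h.2 x
    have := h'.2 x
    have := (l1_mono hs x).trans (l1_union _ _ x)
    have := (l2_mono hs x).trans (l2_union _ _ x)
    have := (l3_mono hs x).trans (l3_union _ _ x)
    omega

section latfacts
variable {L : Finset (V × V × V)}
lemma Lat.u3 (h : Lat L) {x y z z' : V} (a : (x, y, z) ∈ L) (b : (x, y, z') ∈ L) : z = z' := by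
  obtain ⟨s, c, r, h⟩ := h
  rw [(h _ _ _).1] at a b; rw [← a, ← b]
lemma Lat.u2 (h : Lat L) {x y y' z : V} (a : (x, y, z) ∈ L) (b : (x, y', z) ∈ L) : y = y' := by
  obtain ⟨s, c, r, h⟩ := h
  rw [(h _ _ _).2.1] at a b; rw [← a, ← b]
lemma Lat.u1 (h : Lat L) {x x' y z : V} (a : (x, y, z) ∈ L) (b : (x', y, z) ∈ L) : x = x' := by
  obtain ⟨s, c, r, h⟩ := h
  rw [(h _ _ _).2.2] at a b; rw [← a, ← b]
lemma Lat.e3 (h : Lat L) (x y : V) : ∃ z, (x, y, z) ∈ L := by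
  obtain ⟨s, c, r, h⟩ := h; exact ⟨s x y, (h _ _ _).1.2 rfl⟩
lemma Lat.e2 (h : Lat L) (x z : V) : ∃ y, (x, y, z) ∈ L := by
  obtain ⟨s, c, r, h⟩ := h; exact ⟨c x z, (h _ _ _).2.1.2 rfl⟩
lemma Lat.e1 (h : Lat L) (y z : V) : ∃ x, (x, y, z) ∈ L := by
  obtain ⟨s, c, r, h⟩ := h; exact ⟨r y z, (h _ _ _).2.2.2 rfl⟩

lemma Lat.mk' 
    (e3 : ∀ x y, ∃ z, (x, y, z) ∈ L) (e2 : ∀ x z, ∃ y, (x, y, z) ∈ L)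
    (e1 : ∀ y z, ∃ x, (x, y, z) ∈ L)
    (u3 : ∀ x y z z', (x, y, z) ∈ L → (x, y, z') ∈ L → z = z')
    (u2 : ∀ x y y' z, (x, y, z) ∈ L → (x, y', z) ∈ L → y = y')
    (u1 : ∀ x x' y z, (x, y, z) ∈ L → (x', y, z) ∈ L → x = x') : Lat L := by
  choose s hs using e3
  choose c hc using e2
  choose r hr using e1
  refine ⟨s, c, r, fun x y z => ⟨⟨fun h => u3 _ _ _ _ (hs x y) h, fun h => h ▸ hs x y⟩,
    ⟨fun h => u2 _ _ _ _ (hc x z) h, fun h => h ▸ hc x z⟩,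
    ⟨fun h => u1 _ _ _ _ (hr y z) h, fun h => h ▸ hr y z⟩⟩⟩
end latfacts

set_option maxHeartbeats 4000000 in
lemma flip {L : Finset (V × V × V)} (hL : Lat L) {x x1 y y1 z z1 : V} (hz : z ≠ z1)
    (h1 : (x, y, z1) ∈ L) (h2 : (x, y1, z) ∈ L) (h3 : (x1, y, z) ∈ L) (h4 : (x1, y1, z1) ∈ L) :
    ∃ L', Lat L' ∧ Near 1 L L' ∧ (x, y, z) ∈ L' ∧
      ∀ t ∈ L, t ≠ (x, y, z1) → t ≠ (x, y1, z) → t ≠ (x1, y, z) → t ≠ (x1, y1, z1) → t ∈ L' := by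
  have hx : x ≠ x1 := by rintro rfl; exact hz (hL.u3 h3 h1)
  have hy : y ≠ y1 := by rintro rfl; exact hz (hL.u3 h2 h1)
  set R : Finset (V × V × V) := {(x, y, z1), (x, y1, z), (x1, y, z), (x1, y1, z1)} with hR
  set A : Finset (V × V × V) := {(x, y, z), (x, y1, z1), (x1, y, z1), (x1, y1, z)} with hA
  have hm : ∀ t, t ∈ (L \ R) ∪ A ↔ (t ∈ L ∧ t ≠ (x, y, z1) ∧ t ≠ (x, y1, z) ∧ t ≠ (x1, y, z) ∧
      t ≠ (x1, y1, z1)) ∨ t = (x, y, z) ∨ t = (x, y1, z1) ∨ t = (x1, y, z1) ∨ t = (x1, y1, z) := by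
    intro t; simp only [hR, hA, mem_union, mem_sdiff, mem_insert, mem_singleton]; tauto
  refine ⟨(L \ R) ∪ A, ?_, ?_, ?_, ?_⟩
  · have U1 := @Lat.u1 V _ _ L hL
    have U2 := @Lat.u2 V _ _ L hL
    have U3 := @Lat.u3 V _ _ L hL
    apply Lat.mk'
    · intro a b
      obtain ⟨w, hw⟩ := hL.e3 a b
      by_cases k1 : a = x <;> by_cases k2 : a = x1 <;> by_cases k3 : b = y <;> by_cases k4 : b = y1 <;>
        simp only [hm] <;> grind
    · intro a b
      obtain ⟨w, hw⟩ := hL.e2 a b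
      by_cases k1 : a = x <;> by_cases k2 : a = x1 <;> by_cases k3 : b = z <;> by_cases k4 : b = z1 <;>
        simp only [hm] <;> grind
    · intro a b
      obtain ⟨w, hw⟩ := hL.e1 a b
      by_cases k1 : a = y <;> by_cases k2 : a = y1 <;> by_cases k3 : b = z <;> by_cases k4 : b = z1 <;>
        simp only [hm] <;> grind
    · intro a b w w'; simp only [hm]; grind
    · intro a b w w'; simp only [hm]; grind
    · intro a b w w'; simp only [hm]; grind
  · have hs : ((L \ R) ∪ A) \ L ⊆ A := by
      intro t; simp only [mem_union, mem_sdiff]; tauto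
    refine ⟨(card_le_card hs).trans card_le_four, fun w => ⟨?_, ?_, ?_⟩⟩
    · refine (l1_mono hs w).trans ?_
      have : A.filter (fun t => t.1 = w) ⊆ if w = x then {(x, y, z), (x, y1, z1)} else
          {(x1, y, z1), (x1, y1, z)} := by
        clear hm hs
        intro t
        simp only [hA, mem_filter, mem_insert, mem_singleton]
        rintro ⟨rfl | rfl | rfl | rfl, h⟩ <;> simp only at h <;> subst h <;> simp_all [Ne.symm]
      refine (card_le_card this).trans ?_
      split_ifs <;> exact card_le_two
    · refine (l2_mono hs w).trans ?_
      have : A.filter (fun t => t.2.1 = w) ⊆ if w = y then {(x, y, z), (x1, y, z1)} else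
          {(x, y1, z1), (x1, y1, z)} := by
        clear hm hs
        intro t
        simp only [hA, mem_filter, mem_insert, mem_singleton]
        rintro ⟨rfl | rfl | rfl | rfl, h⟩ <;> simp only at h <;> subst h <;> simp_all [Ne.symm]
      refine (card_le_card this).trans ?_
      split_ifs <;> exact card_le_two
    · refine (l3_mono hs w).trans ?_
      have : A.filter (fun t => t.2.2 = w) ⊆ if w = z then {(x, y, z), (x1, y1, z)} else
          {(x, y1, z1), (x1, y, z1)} := by
        clear hm hs
        intro t
        simp only [hA, mem_filter, mem_insert, mem_singleton]
        rintro ⟨rfl | rfl | rfl | rfl, h⟩ <;> simp only at h <;> subst h <;> simp_all [Ne.symm]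
      refine (card_le_card this).trans ?_
      split_ifs <;> exact card_le_two
  · rw [hm]; simp
  · intro t ht a b c d; rw [hm]; tauto

/-! ### Counting helpers -/

open Classical in
/-- At most `k` elements satisfy `p`. -/
def Few (p : V → Prop) (k : ℕ) : Prop := (univ.filter p).card ≤ k

lemma Few.or {p q : V → Prop} {a b : ℕ} (h : Few p a) (h' : Few q b) :
    Few (fun x => p x ∨ q x) (a + b) := by
  classical
  unfold Few at *
  refine le_trans (card_le_card ?_) ((card_union_le _ _).trans (Nat.add_le_add h h'))
  intro x
  simp

lemma Few.mono {p : V → Prop} {a b : ℕ} (h : Few p a) (h' : a ≤ b) : Few p b := le_trans h h'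

lemma Few.exists_good {p : V → Prop} {a : ℕ} (h : Few p a) (S : Finset V) (hS : a < S.card) :
    ∃ x ∈ S, ¬ p x := by
  classical
  by_contra hc
  push Not at hc
  have : S ⊆ univ.filter p := fun x hx => by simp [hc x hx]
  have := card_le_card this
  unfold Few at h
  have h2 : (univ.filter p).card ≤ a := by convert h
  omega

lemma Few.eq (a : V) : Few (fun x => x = a) 1 := by
  classical
  unfold Few
  rw [card_le_one]
  simp

lemma Few.f1 {f : V → V × V × V} (hf : Function.Injective f) (U : Finset (V × V × V)) (x : V)
    (h : ∀ X, (f X).1 = x) : Few (fun X => f X ∈ U) (l1 U x) := by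
  classical
  unfold Few l1
  refine card_le_card_of_injOn f ?_ hf.injOn
  intro X hX
  simp at hX ⊢
  exact ⟨hX, h X⟩
lemma Few.f2 {f : V → V × V × V} (hf : Function.Injective f) (U : Finset (V × V × V)) (x : V)
    (h : ∀ X, (f X).2.1 = x) : Few (fun X => f X ∈ U) (l2 U x) := by
  classical
  unfold Few l2
  refine card_le_card_of_injOn f ?_ hf.injOn
  intro X hX
  simp at hX ⊢
  exact ⟨hX, h X⟩
lemma Few.f3 {f : V → V × V × V} (hf : Function.Injective f) (U : Finset (V × V × V)) (x : V)
    (h : ∀ X, (f X).2.2 = x) : Few (fun X => f X ∈ U) (l3 U x) := by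
  classical
  unfold Few l3
  refine card_le_card_of_injOn f ?_ hf.injOn
  intro X hX
  simp at hX ⊢
  exact ⟨hX, h X⟩

lemma Few.comp {p : V → Prop} {k : ℕ} (h : Few p k) {f : V → V} (hf : Function.Injective f) :
    Few (fun X => p (f X)) k := by
  classical
  unfold Few at *
  refine le_trans ?_ h
  refine card_le_card_of_injOn f ?_ hf.injOn
  intro X hX
  simpa using hX

/-! ### Base structure -/

structure Base (B : Finset (V × V × V)) (ρ γ σ : V → Bool) (q : ℕ) : Prop where
  par : ∀ x y z, (x, y, z) ∈ B → (ρ x ^^ γ y ^^ σ z) = false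
  Q1 : ∀ x y z x1 y1 z1 x2, (x, y, z1) ∈ B → (x, y1, z) ∈ B → (x1, y, z) ∈ B → (x2, y1, z1) ∈ B →
    (ρ x ^^ γ y ^^ σ z) = true → x2 = x1
  Q3 : ∀ x y z x1 y1 z1 z2, (x, y, z1) ∈ B → (x, y1, z) ∈ B → (x1, y, z) ∈ B → (x1, y1, z2) ∈ B →
    (ρ x ^^ γ y ^^ σ z) = true → z2 = z1
  cρ : ∀ b, q ≤ (univ.filter (fun x => ρ x = b)).card
  cσ : ∀ b, q ≤ (univ.filter (fun x => σ x = b)).card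

/-- Unclean triples. -/
def Un (L B F : Finset (V × V × V)) : Finset (V × V × V) := L \ (B \ F)

def Cl (L B F : Finset (V × V × V)) (t : V × V × V) : Prop := t ∈ L ∧ t ∈ B ∧ t ∉ F

lemma Cl.of {L B F : Finset (V × V × V)} {t : V × V × V} (h : t ∈ L) (h' : t ∉ Un L B F) :
    Cl L B F t := by
  unfold Un at h'; unfold Cl; simp only [mem_sdiff] at h'; tauto

/-- Bundle of data on heavy lines. -/
def HC (L B F : Finset (V × V × V)) (g H : ℕ) : Prop :=
  Few (fun x => g < l1 (Un L B F) x) H ∧ Few (fun x => g < l2 (Un L B F) x) H ∧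
    Few (fun x => g < l3 (Un L B F) x) H

lemma Un_sub (L L' B F E : Finset (V × V × V)) :
    Un L' B (F ∪ E) ⊆ (Un L B F ∪ (L' \ L)) ∪ E := by
  intro t; unfold Un; simp only [mem_sdiff, mem_union]; tauto

lemma Un_l1 {L L' B F E : Finset (V × V × V)} {k e : ℕ} (h : Near k L L') (he : E.card ≤ e)
    {x : V} {g g' : ℕ} (hx : l1 (Un L B F) x ≤ g) (hg : g + 2 * k + e ≤ g') :
    l1 (Un L' B (F ∪ E)) x ≤ g' := by
  have := l1_mono (Un_sub L L' B F E) x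
  have := l1_union (Un L B F ∪ (L' \ L)) E x
  have := l1_union (Un L B F) (L' \ L) x
  have := h.2 x
  have := l1_card E x
  omega
lemma Un_l2 {L L' B F E : Finset (V × V × V)} {k e : ℕ} (h : Near k L L') (he : E.card ≤ e)
    {x : V} {g g' : ℕ} (hx : l2 (Un L B F) x ≤ g) (hg : g + 2 * k + e ≤ g') :
    l2 (Un L' B (F ∪ E)) x ≤ g' := by
  have := l2_mono (Un_sub L L' B F E) x
  have := l2_union (Un L B F ∪ (L' \ L)) E x
  have := l2_union (Un L B F) (L' \ L) x
  have := h.2 x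
  have := l2_card E x
  omega
lemma Un_l3 {L L' B F E : Finset (V × V × V)} {k e : ℕ} (h : Near k L L') (he : E.card ≤ e)
    {x : V} {g g' : ℕ} (hx : l3 (Un L B F) x ≤ g) (hg : g + 2 * k + e ≤ g') :
    l3 (Un L' B (F ∪ E)) x ≤ g' := by
  have := l3_mono (Un_sub L L' B F E) x
  have := l3_union (Un L B F ∪ (L' \ L)) E x
  have := l3_union (Un L B F) (L' \ L) x
  have := h.2 x
  have := l3_card E x
  omega

lemma Few.imp {p p' : V → Prop} {k : ℕ} (h : Few p k) (hp : ∀ x, p' x → p x) : Few p' k := by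
  classical
  unfold Few at *
  refine le_trans (card_le_card ?_) h
  intro x; simp; exact hp x

lemma HC.up {L L' B F E : Finset (V × V × V)} {k e : ℕ} (h : Near k L L') (he : E.card ≤ e)
    {g g' H : ℕ} (hc : HC L B F g H) (hg : g + 2 * k + e ≤ g') : HC L' B (F ∪ E) g' H := by
  refine ⟨hc.1.imp fun x hx => ?_, hc.2.1.imp fun x hx => ?_, hc.2.2.imp fun x hx => ?_⟩
  · by_contra hh
    have := Un_l1 (B := B) (F := F) h he (not_lt.1 hh) hg
    omega
  · by_contra hh
    have := Un_l2 (B := B) (F := F) h he (not_lt.1 hh) hg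
    omega
  · by_contra hh
    have := Un_l3 (B := B) (F := F) h he (not_lt.1 hh) hg
    omega

section inj
variable {L : Finset (V × V × V)} {s c r : V → V → V}
/-- the functions witnessing `Lat` -/
def Fn (L : Finset (V × V × V)) (s c r : V → V → V) : Prop :=
  ∀ x y z, ((x, y, z) ∈ L ↔ s x y = z) ∧ ((x, y, z) ∈ L ↔ c x z = y) ∧ ((x, y, z) ∈ L ↔ r y z = x)

lemma Fn.ms (h : Fn L s c r) (x y : V) : (x, y, s x y) ∈ L := (h _ _ _).1.2 rfl
lemma Fn.mc (h : Fn L s c r) (x z : V) : (x, c x z, z) ∈ L := (h _ _ _).2.1.2 rfl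
lemma Fn.mr (h : Fn L s c r) (y z : V) : (r y z, y, z) ∈ L := (h _ _ _).2.2.2 rfl
lemma Fn.lat (h : Fn L s c r) : Lat L := ⟨s, c, r, h⟩
lemma Fn.is1 (h : Fn L s c r) (y : V) : Function.Injective (fun x => s x y) := by
  intro a b hab
  have h1 := h.ms a y
  have h2 := h.ms b y
  simp only at hab
  rw [hab] at h1
  exact h.lat.u1 h1 h2
lemma Fn.is2 (h : Fn L s c r) (x : V) : Function.Injective (fun y => s x y) := by
  intro a b hab
  have h1 := h.ms x a
  have h2 := h.ms x b
  simp only at hab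
  rw [hab] at h1
  exact h.lat.u2 h1 h2
lemma Fn.ic1 (h : Fn L s c r) (z : V) : Function.Injective (fun x => c x z) := by
  intro a b hab
  have h1 := h.mc a z
  have h2 := h.mc b z
  simp only at hab
  rw [hab] at h1
  exact h.lat.u1 h1 h2
lemma Fn.ic2 (h : Fn L s c r) (x : V) : Function.Injective (fun z => c x z) := by
  intro a b hab
  have h1 := h.mc x a
  have h2 := h.mc x b
  simp only at hab
  rw [hab] at h1
  exact h.lat.u3 h1 h2
lemma Fn.ir1 (h : Fn L s c r) (z : V) : Function.Injective (fun y => r y z) := by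
  intro a b hab
  have h1 := h.mr a z
  have h2 := h.mr b z
  simp only at hab
  rw [hab] at h1
  exact h.lat.u2 h1 h2
lemma Fn.ir2 (h : Fn L s c r) (y : V) : Function.Injective (fun z => r y z) := by
  intro a b hab
  have h1 := h.mr y a
  have h2 := h.mr y b
  simp only at hab
  rw [hab] at h1
  exact h.lat.u3 h1 h2
end inj

lemma i1 {f : V → V × V × V} (h : Function.Injective (fun X => (f X).1)) : Function.Injective f :=
  fun a b hab => h (by simp only [hab])
lemma i2 {f : V → V × V × V} (h : Function.Injective (fun X => (f X).2.1)) : Function.Injective f :=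
  fun a b hab => h (by simp only [hab])
lemma i3 {f : V → V × V × V} (h : Function.Injective (fun X => (f X).2.2)) : Function.Injective f :=
  fun a b hab => h (by simp only [hab])

lemma Pl.self {L F : Finset (V × V × V)} (hL : Lat L) (hF : F ⊆ L) {t : V × V × V} (ht : t ∈ L)
    (k : ℕ) : Pl k L F t := ⟨L, hL, (Near.refl L).mono (by omega), ht, hF⟩

lemma Pl.mono {L F : Finset (V × V × V)} {t : V × V × V} {k k' : ℕ} (h : Pl k L F t) (hk : k ≤ k') :
    Pl k' L F t := by
  obtain ⟨L', a, b, c⟩ := h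
  exact ⟨L', a, b.mono hk, c⟩

lemma flipF {L F : Finset (V × V × V)} (hL : Lat L) (hF : F ⊆ L) {x x1 y y1 z z1 : V}
    (h1 : (x, y, z1) ∈ L) (h2 : (x, y1, z) ∈ L) (h3 : (x1, y, z) ∈ L) (h4 : (x1, y1, z1) ∈ L)
    (f1 : (x, y, z1) ∉ F) (f2 : (x, y1, z) ∉ F) (f3 : (x1, y, z) ∉ F) (f4 : (x1, y1, z1) ∉ F) :
    Pl 1 L F (x, y, z) := by
  by_cases hz : z = z1
  · subst hz; exact Pl.self hL hF h1 _
  obtain ⟨L', a, b, c, d⟩ := flip hL hz h1 h2 h3 h4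
  refine ⟨L', a, b, c, fun t ht => d t (hF ht) ?_ ?_ ?_ ?_⟩ <;> (rintro rfl; contradiction)

lemma bool1 : ∀ a b c a' : Bool, (a ^^ b ^^ c) = false → (a' ^^ b ^^ c) = false → a' = a := by
  decide
lemma bool2 : ∀ a b c a' b' c' : Bool, (a ^^ b ^^ c) = false → (a ^^ b ^^ c') = false →
    (a ^^ b' ^^ c) = false → (a' ^^ b' ^^ c') = false → a' = a := by
  decide
lemma bool3 : ∀ a b c a' : Bool, (a ^^ b ^^ c) = false → a' = !a → (a' ^^ b ^^ c) = true := by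
  decide

set_option maxHeartbeats 1000000 in
lemma place0 {B : Finset (V × V × V)} {ρ γ σ : V → Bool} {q : ℕ} (hB : Base B ρ γ σ q)
    {L F : Finset (V × V × V)} (hL : Lat L) (hF : F ⊆ L) {g : ℕ} {x y z x1 y1 z1 x2 : V}
    (c1 : Cl L B F (x, y, z1)) (c2 : Cl L B F (x, y1, z)) (c3 : Cl L B F (x1, y, z))
    (c4 : Cl L B F (x2, y1, z1))
    (g1 : l2 (Un L B F) y ≤ g) (g2 : l3 (Un L B F) z ≤ g) (g3 : l1 (Un L B F) x1 ≤ g)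
    (g4 : l2 (Un L B F) y1 ≤ g) (g5 : l3 (Un L B F) z1 ≤ g) (g6 : l1 (Un L B F) x2 ≤ g)
    (hg : 6 * g < q) : Pl 3 L F (x, y, z) := by
  by_cases hz : z = z1
  · subst hz; exact Pl.self hL hF c1.1 _
  by_cases hx : x1 = x2
  · subst hx
    exact (flipF hL hF c1.1 c2.1 c3.1 c4.1 c1.2.2 c2.2.2 c3.2.2 c4.2.2).mono (by omega)
  have par : (ρ x ^^ γ y ^^ σ z) = false := by
    by_contra hh
    exact hx (hB.Q1 _ _ _ _ _ _ _ c1.2.1 c2.2.1 c3.2.1 c4.2.1 (by simpa using hh)).symm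
  have p1 := hB.par _ _ _ c1.2.1
  have p2 := hB.par _ _ _ c2.2.1
  have p3 := hB.par _ _ _ c3.2.1
  have p4 := hB.par _ _ _ c4.2.1
  have r1 : ρ x1 = ρ x := bool1 _ _ _ _ par p3
  have r2 : ρ x2 = ρ x := bool2 _ _ _ _ _ _ par p1 p2 p4
  obtain ⟨s, c, r, hfn⟩ := hL
  have hfn : Fn L s c r := hfn
  have hL : Lat L := hfn.lat
  have few := ((((((Few.f2 (i1 (f := fun X => (X, y, s X y)) Function.injective_id) (Un L B F) y
      fun _ => rfl).mono g1).or
    ((Few.f3 (i1 (f := fun X => (X, c X z, z)) Function.injective_id) (Un L B F) z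
      fun _ => rfl).mono g2)).or
    ((Few.f1 (i2 (f := fun X => (x1, c X z, s x1 (c X z))) (hfn.ic1 z)) (Un L B F) x1
      fun _ => rfl).mono g3)).or
    ((Few.f2 (i1 (f := fun X => (X, y1, s X y1)) Function.injective_id) (Un L B F) y1
      fun _ => rfl).mono g4)).or
    ((Few.f3 (i1 (f := fun X => (X, c X z1, z1)) Function.injective_id) (Un L B F) z1
      fun _ => rfl).mono g5)).or
    ((Few.f1 (i2 (f := fun X => (x2, c X z1, s x2 (c X z1))) (hfn.ic1 z1)) (Un L B F) x2
      fun _ => rfl).mono g6)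
  obtain ⟨X, hX, hXn⟩ := few.exists_good (univ.filter (fun X => ρ X = !(ρ x)))
    (lt_of_lt_of_le (by omega) (hB.cρ _))
  simp only [mem_filter, mem_univ, true_and] at hX
  simp only [not_or] at hXn
  obtain ⟨⟨⟨⟨⟨k1, k2⟩, k3⟩, k4⟩, k5⟩, k6⟩ := hXn
  have d1 := Cl.of (hfn.ms X y) k1
  have d2 := Cl.of (hfn.mc X z) k2
  have d3 := Cl.of (hfn.ms x1 (c X z)) k3
  have d4 := Cl.of (hfn.ms X y1) k4
  have d5 := Cl.of (hfn.mc X z1) k5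
  have d6 := Cl.of (hfn.ms x2 (c X z1)) k6
  clear k1 k2 k3 k4 k5 k6 few
  generalize s X y = w at *
  generalize c X z = v at *
  generalize s x1 v = w2 at *
  generalize s X y1 = w' at *
  generalize c X z1 = v' at *
  generalize s x2 v' = w2' at *
  have e1 : w2 = w := hB.Q3 _ _ _ _ _ _ _ d1.2.1 d2.2.1 c3.2.1 d3.2.1 (bool3 _ _ _ _ par hX)
  have e2 : w2' = w' := hB.Q3 _ _ _ _ _ _ _ d4.2.1 d5.2.1 c4.2.1 d6.2.1 (bool3 _ _ _ _ p4 (by rw [r2]; exact hX))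
  subst e1 e2
  have hXx : X ≠ x := by rintro rfl; simp at hX
  have hXx1 : X ≠ x1 := by rintro rfl; simp [r1] at hX
  have hXx2 : X ≠ x2 := by rintro rfl; simp [r2] at hX
  have hyy : y ≠ y1 := by rintro rfl; exact hz (hL.u3 c2.1 c1.1)
  have hxx1 : x ≠ x1 := by rintro rfl; exact hz (hL.u3 c3.1 c1.1)
  have hxx2 : x ≠ x2 := by rintro rfl; exact hz (hL.u3 c2.1 c4.1)
  have hzw : z ≠ w2 := by rintro rfl; exact hXx1 (hL.u1 d1.1 c3.1)
  have hzw' : z1 ≠ w2' := by rintro rfl; exact hXx2 (hL.u1 d4.1 c4.1)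
  obtain ⟨L1, hL1, n1, m1, q1⟩ := flip hL hzw d1.1 d2.1 c3.1 d3.1
  have q1' : ∀ t ∈ L, t.1 ≠ X → t.1 ≠ x1 → t ∈ L1 := by
    intro t ht a b
    refine q1 t ht ?_ ?_ ?_ ?_ <;> (rintro rfl; simp at a b)
  have t4 : (X, y1, w2') ∈ L1 := by
    refine q1 _ d4.1 (by simp [hyy.symm]) ?_ (by simp [hXx1]) (by simp [hXx1])
    simp only [ne_eq, Prod.mk.injEq, true_and, not_and]
    rintro rfl rfl
    exact hXx (hL.u1 d4.1 c2.1)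
  have t5 : (X, v', z1) ∈ L1 := by
    refine q1 _ d5.1 ?_ (by simp [Ne.symm hz]) (by simp [hXx1]) (by simp [hXx1])
    simp only [ne_eq, Prod.mk.injEq, true_and, not_and]
    rintro rfl rfl
    exact hXx (hL.u1 d5.1 c1.1)
  obtain ⟨L2, hL2, n2, m2, q2⟩ := flip hL1 hzw' t4 t5 (q1' _ c4.1 hXx2.symm (Ne.symm hx))
    (q1' _ d6.1 hXx2.symm (Ne.symm hx))
  have q2' : ∀ t ∈ L1, t.1 ≠ X → t.1 ≠ x2 → t ∈ L2 := by
    intro t ht a b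
    refine q2 t ht ?_ ?_ ?_ ?_ <;> (rintro rfl; simp at a b)
  have F1 : F ⊆ L1 := fun t ht => q1 t (hF ht) (by rintro rfl; exact d1.2.2 ht)
    (by rintro rfl; exact d2.2.2 ht) (by rintro rfl; exact c3.2.2 ht)
    (by rintro rfl; exact d3.2.2 ht)
  have F2 : F ⊆ L2 := fun t ht => q2 t (F1 ht) (by rintro rfl; exact d4.2.2 ht)
    (by rintro rfl; exact d5.2.2 ht) (by rintro rfl; exact c4.2.2 ht)
    (by rintro rfl; exact d6.2.2 ht)
  have m1' : (X, y, z) ∈ L2 := q2 _ m1 (by simp [hyy]) (by simp [hz]) (by simp [hXx2])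
    (by simp [hXx2])
  obtain ⟨L3, hL3, n3, m3, q3⟩ := flipF hL2 F2
    (q2' _ (q1' _ c1.1 hXx.symm hxx1) hXx.symm hxx2)
    (q2' _ (q1' _ c2.1 hXx.symm hxx1) hXx.symm hxx2) m1' m2 c1.2.2 c2.2.2
    (fun h => hXx1 (hL.u1 (hF h) c3.1)) (fun h => hXx2 (hL.u1 (hF h) c4.1))
  exact ⟨L3, hL3, (n1.trans n2).trans n3, m3, q3⟩
/-! ### Placing a triple whose symbol is arbitrary -/

lemma Cl.union {L B F E L' : Finset (V × V × V)} {t : V × V × V} (h : Cl L B F t) (hL : t ∈ L')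
    (h' : t ∉ E) : Cl L' B (F ∪ E) t :=
  ⟨hL, h.2.1, by simp only [mem_union, not_or]; exact ⟨h.2.2, h'⟩⟩

set_option maxHeartbeats 1000000 in
lemma place1 {B : Finset (V × V × V)} {ρ γ σ : V → Bool} {q : ℕ} (hB : Base B ρ γ σ q)
    {L F : Finset (V × V × V)} (hL : Lat L) (hF : F ⊆ L) {g H : ℕ} (hH : HC L B F g H)
    {x y z x' y' z1 z1' : V}
    (h1 : (x, y', z) ∈ L) (h2 : (x', y, z) ∈ L)
    (c1 : Cl L B F (x, y, z1)) (c2 : Cl L B F (x', y', z1'))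
    (f1 : (x, y', z) ∉ F) (f2 : (x', y, z) ∉ F)
    (g1 : l1 (Un L B F) x ≤ g) (g2 : l2 (Un L B F) y ≤ g) (g3 : l3 (Un L B F) z1 ≤ g)
    (g4 : l1 (Un L B F) x' ≤ g) (g5 : l2 (Un L B F) y' ≤ g) (g6 : l3 (Un L B F) z1' ≤ g)
    (hn : 6 * g + 7 * H + 3 < Fintype.card V)
    (hg : 6 * (g + 9) < q) : Pl 7 L F (x, y, z) := by
  by_cases hz : z = z1
  · subst hz; exact Pl.self hL hF c1.1 _
  have hxx : x ≠ x' := by rintro rfl; exact hz (hL.u3 h2 c1.1)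
  have hyy : y ≠ y' := by rintro rfl; exact hz (hL.u3 h1 c1.1)
  have hz' : z ≠ z1' := by rintro rfl; exact hxx (hL.u1 h1 c2.1)
  obtain ⟨s, c, r, hfn⟩ := hL
  have hfn : Fn L s c r := hfn
  have hL : Lat L := hfn.lat
  have few := ((Few.eq z).or (Few.eq z1)).or (Few.eq z1')
  have few := few.or hH.2.2
  have few := few.or ((Few.f1 (i3 (f := fun A => (x, c x A, A)) Function.injective_id)
    (Un L B F) x fun _ => rfl).mono g1)
  have few := few.or ((Few.f2 (i3 (f := fun A => (r y A, y, A)) Function.injective_id)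
    (Un L B F) y fun _ => rfl).mono g2)
  have few := few.or ((Few.f3 (i2 (f := fun A => (r (c x A) z1, c x A, z1)) (hfn.ic2 x))
    (Un L B F) z1 fun _ => rfl).mono g3)
  have few := few.or (hH.1.comp (hfn.ir2 y))
  have few := few.or (hH.1.comp ((hfn.ir1 z1).comp (hfn.ic2 x)))
  have few := few.or (hH.2.1.comp (hfn.ic2 x))
  have few := few.or ((Few.f1 (i3 (f := fun A => (x', c x' A, A)) Function.injective_id)
    (Un L B F) x' fun _ => rfl).mono g4)
  have few := few.or ((Few.f2 (i3 (f := fun A => (r y' A, y', A)) Function.injective_id)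
    (Un L B F) y' fun _ => rfl).mono g5)
  have few := few.or ((Few.f3 (i2 (f := fun A => (r (c x' A) z1', c x' A, z1')) (hfn.ic2 x'))
    (Un L B F) z1' fun _ => rfl).mono g6)
  have few := few.or (hH.1.comp (hfn.ir2 y'))
  have few := few.or (hH.1.comp ((hfn.ir1 z1').comp (hfn.ic2 x')))
  have few := few.or (hH.2.1.comp (hfn.ic2 x'))
  obtain ⟨A, -, hA⟩ := few.exists_good univ (by rw [card_univ]; omega)
  clear few
  simp only [not_or, not_lt, Function.comp] at hA
  obtain ⟨⟨⟨⟨⟨⟨⟨⟨⟨⟨⟨⟨⟨⟨⟨A1, A2⟩, A3⟩, wA⟩, k1⟩, k2⟩, k3⟩, w1⟩, w2⟩, w3⟩, k4⟩, k5⟩, k6⟩, w4⟩, w5⟩, w6⟩ := hA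
  have d1 := Cl.of (hfn.mc x A) k1
  have d2 := Cl.of (hfn.mr y A) k2
  have d3 := Cl.of (hfn.mr (c x A) z1) k3
  have d4 := Cl.of (hfn.mc x' A) k4
  have d5 := Cl.of (hfn.mr y' A) k5
  have d6 := Cl.of (hfn.mr (c x' A) z1') k6
  clear k1 k2 k3 k4 k5 k6
  generalize c x A = p at *
  generalize r y A = o at *
  generalize r p z1 = u at *
  generalize c x' A = p' at *
  generalize r y' A = o' at *
  generalize r p' z1' = u' at *
  have e1 : p ≠ y' := by rintro rfl; exact A1 (hL.u3 d1.1 h1)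
  have e2 : p' ≠ y := by rintro rfl; exact A1 (hL.u3 d4.1 h2)
  have e3 : p ≠ p' := by rintro rfl; exact hxx (hL.u1 d1.1 d4.1)
  have sy : ∀ {a b : V}, a ≠ b → b ≠ a := fun h => h.symm
  obtain ⟨E1, hE1⟩ : ∃ E : Finset (V × V × V), E = {(x, y', z), (x', y, z), (x', y', z1'),
    (x', p', A), (o', y', A), (u', p', z1')} := ⟨_, rfl⟩
  have E1c : E1.card ≤ 6 := by rw [hE1]; exact card_le_six
  have F1 : F ∪ E1 ⊆ L := by
    refine union_subset hF ?_
    rw [hE1]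
    intro t; simp only [mem_insert, mem_singleton]
    rintro (rfl | rfl | rfl | rfl | rfl | rfl)
    exacts [h1, h2, c2.1, d4.1, d5.1, d6.1]
  have N0 := Near.refl L
  obtain ⟨L1, hL1, n1, m1, q1⟩ := place0 (g := g + 9) hB hL F1
    (c1.union c1.1 (by rw [hE1]; simp [hyy, hxx, sy e2]))
    (d1.union d1.1 (by rw [hE1]; simp [hxx, e1, A1, A3]))
    (d2.union d2.1 (by rw [hE1]; simp [hyy, sy e2, A1, A3]))
    (d3.union d3.1 (by rw [hE1]; simp [e1, e3, sy hz, sy A2]))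
    (Un_l2 N0 E1c g2 (by omega)) (Un_l3 N0 E1c wA (by omega)) (Un_l1 N0 E1c w1 (by omega))
    (Un_l2 N0 E1c w3 (by omega)) (Un_l3 N0 E1c g3 (by omega)) (Un_l1 N0 E1c w2 (by omega)) hg
  obtain ⟨E2, hE2⟩ : ∃ E : Finset (V × V × V), E = {(x, y, A), (x, y', z), (x', y, z)} := ⟨_, rfl⟩
  have E2c : E2.card ≤ 3 := by rw [hE2]; exact card_le_three
  have hE1L : E1 ⊆ L1 := subset_union_right.trans q1
  have j : ∀ t ∈ E1, t ∈ L1 := fun t ht => hE1L ht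
  simp only [hE1, mem_insert, mem_singleton, forall_eq_or_imp, forall_eq] at j
  obtain ⟨j1, j2, j3, j4, j5, j6⟩ := j
  have F2 : F ∪ E2 ⊆ L1 := by
    refine union_subset (subset_union_left.trans q1) ?_
    rw [hE2]
    intro t; simp only [mem_insert, mem_singleton]
    rintro (rfl | rfl | rfl)
    exacts [m1, j1, j2]
  obtain ⟨L2, hL2, n2, m2, q2⟩ := place0 (g := g + 9) hB hL1 F2
    (c2.union j3 (by rw [hE2]; simp [sy hyy, sy hxx, sy hz']))
    (d4.union j4 (by rw [hE2]; simp [sy hxx, A1]))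
    (d5.union j5 (by rw [hE2]; simp [sy hyy, A1]))
    (d6.union j6 (by rw [hE2]; simp [sy A3, sy hz']))
    (Un_l2 n1 E2c g5 (by omega)) (Un_l3 n1 E2c wA (by omega)) (Un_l1 n1 E2c w4 (by omega))
    (Un_l2 n1 E2c w6 (by omega)) (Un_l3 n1 E2c g6 (by omega)) (Un_l1 n1 E2c w5 (by omega)) hg
  have hE2L : E2 ⊆ L2 := subset_union_right.trans q2
  have j : ∀ t ∈ E2, t ∈ L2 := fun t ht => hE2L ht
  simp only [hE2, mem_insert, mem_singleton, forall_eq_or_imp, forall_eq] at j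
  obtain ⟨j1, j2, j3⟩ := j
  obtain ⟨L3, hL3, n3, m3, q3⟩ := flipF hL2 (subset_union_left.trans q2) j1 j2 j3 m2
    (fun h => A2 (hL.u3 (hF h) c1.1)) f1 f2 (fun h => A3 (hL.u3 (hF h) c2.1))
  exact ⟨L3, hL3, (n1.trans n2).trans n3, m3, q3⟩

/-! ### Row/symbol symmetry -/

def sw (t : V × V × V) : V × V × V := (t.2.2, t.2.1, t.1)

lemma sw_sw (t : V × V × V) : sw (sw t) = t := rfl

lemma sw_inj : Function.Injective (sw : V × V × V → V × V × V) :=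
  Function.LeftInverse.injective (g := sw) sw_sw

def swS (S : Finset (V × V × V)) : Finset (V × V × V) := S.image sw

lemma mem_swS {S : Finset (V × V × V)} {t : V × V × V} : t ∈ swS S ↔ sw t ∈ S := by
  unfold swS
  rw [mem_image]
  exact ⟨fun ⟨a, h, e⟩ => by rw [← e]; exact h, fun h => ⟨_, h, rfl⟩⟩

lemma swS_swS (S : Finset (V × V × V)) : swS (swS S) = S := by
  ext t; simp only [mem_swS, sw_sw]

lemma swS_sdiff (S T : Finset (V × V × V)) : swS S \ swS T = swS (S \ T) := by
  ext t; simp only [mem_sdiff, mem_swS]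

lemma swS_card (S : Finset (V × V × V)) : (swS S).card = S.card :=
  card_image_of_injective _ sw_inj

lemma l1_swS (S : Finset (V × V × V)) (x : V) : l1 (swS S) x = l3 S x := by
  unfold l1 l3
  rw [← swS_card]
  congr 1
  ext t
  simp only [mem_filter, mem_swS, sw]
lemma l2_swS (S : Finset (V × V × V)) (x : V) : l2 (swS S) x = l2 S x := by
  unfold l2
  rw [← swS_card (S.filter _)]
  congr 1
  ext t
  simp only [mem_filter, mem_swS, sw]
lemma l3_swS (S : Finset (V × V × V)) (x : V) : l3 (swS S) x = l1 S x := by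
  conv_rhs => rw [← swS_swS S, l1_swS]

lemma Lat.sw {L : Finset (V × V × V)} (h : Lat L) : Lat (swS L) := by
  apply Lat.mk' <;> simp only [mem_swS, PLS.sw]
  · intro x y; exact h.e1 y x
  · intro x z; exact h.e2 z x
  · intro y z; exact h.e3 z y
  · intro x y z z'; exact h.u1
  · intro x y y' z; exact h.u2
  · intro x x' y z; exact h.u3

lemma Near.sw {k : ℕ} {L L' : Finset (V × V × V)} (h : Near k L L') : Near k (swS L) (swS L') := by
  unfold Near at *
  rw [swS_sdiff, swS_card]
  refine ⟨h.1, fun x => ?_⟩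
  rw [l1_swS, l2_swS, l3_swS]
  have := h.2 x
  tauto

lemma swS_mono {S T : Finset (V × V × V)} (h : S ⊆ T) : swS S ⊆ swS T := image_subset_image h

lemma Pl.sw {k : ℕ} {L F : Finset (V × V × V)} {t : V × V × V} (h : Pl k (swS L) (swS F) t) :
    Pl k L F (sw t) := by
  obtain ⟨L', a, b, c, d⟩ := h
  refine ⟨swS L', a.sw, ?_, ?_, ?_⟩
  · have := b.sw; rwa [swS_swS] at this
  · rw [mem_swS]; exact c
  · have := swS_mono d; rwa [swS_swS] at this

lemma Un_sw (L B F : Finset (V × V × V)) : Un (swS L) (swS B) (swS F) = swS (Un L B F) := by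
  unfold Un; rw [swS_sdiff, swS_sdiff]

lemma Cl.sw {L B F : Finset (V × V × V)} {t : V × V × V} (h : Cl L B F t) :
    Cl (swS L) (swS B) (swS F) (sw t) := by
  unfold Cl; simp only [mem_swS, sw_sw]; exact h

lemma HC.sw {L B F : Finset (V × V × V)} {g H : ℕ} (h : HC L B F g H) :
    HC (swS L) (swS B) (swS F) g H := by
  unfold HC at *
  simp only [Un_sw, l1_swS, l2_swS, l3_swS]
  tauto

lemma bool4 : ∀ a b c : Bool, (a ^^ b ^^ c) = (c ^^ b ^^ a) := by decide

lemma Base.sw {B : Finset (V × V × V)} {ρ γ σ : V → Bool} {q : ℕ} (hB : Base B ρ γ σ q) :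
    Base (swS B) σ γ ρ q := by
  constructor <;> (try simp only [mem_swS, PLS.sw])
  · intro x y z h; rw [bool4]; exact hB.par _ _ _ h
  · intro x y z x1 y1 z1 x2 h1 h2 h3 h4 h5
    rw [bool4] at h5
    exact hB.Q3 _ _ _ _ _ _ _ h3 h2 h1 h4 h5
  · intro x y z x1 y1 z1 z2 h1 h2 h3 h4 h5
    rw [bool4] at h5
    exact hB.Q1 _ _ _ _ _ _ _ h3 h2 h1 h4 h5
  · exact hB.cσ
  · exact hB.cρ

/-- The version of `place1` with an arbitrary row. -/
lemma place1' {B : Finset (V × V × V)} {ρ γ σ : V → Bool} {q : ℕ} (hB : Base B ρ γ σ q)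
    {L F : Finset (V × V × V)} (hL : Lat L) (hF : F ⊆ L) {g H : ℕ} (hH : HC L B F g H)
    {x y z z' y' x1 x1' : V}
    (h1 : (x, y', z) ∈ L) (h2 : (x, y, z') ∈ L)
    (c1 : Cl L B F (x1, y, z)) (c2 : Cl L B F (x1', y', z'))
    (f1 : (x, y', z) ∉ F) (f2 : (x, y, z') ∉ F)
    (g1 : l3 (Un L B F) z ≤ g) (g2 : l2 (Un L B F) y ≤ g) (g3 : l1 (Un L B F) x1 ≤ g)
    (g4 : l3 (Un L B F) z' ≤ g) (g5 : l2 (Un L B F) y' ≤ g) (g6 : l1 (Un L B F) x1' ≤ g)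
    (hn : 6 * g + 7 * H + 3 < Fintype.card V)
    (hg : 6 * (g + 9) < q) : Pl 7 L F (x, y, z) := by
  refine Pl.sw (t := (z, y, x)) ?_
  refine place1 (g := g) (H := H) (x' := z') (y' := y') (z1 := x1) (z1' := x1') hB.sw hL.sw
    (swS_mono hF) hH.sw ?_ ?_ c1.sw c2.sw ?_ ?_ ?_ ?_ ?_ ?_ ?_ ?_ hn hg
  all_goals first
    | (rw [mem_swS]; assumption)
    | (rw [Un_sw]; first
        | (rw [l1_swS]; assumption) | (rw [l2_swS]; assumption) | (rw [l3_swS]; assumption))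
/-! ### Placing an arbitrary triple -/

lemma nmem_union {F E : Finset (V × V × V)} {t : V × V × V} (h : t ∉ F) (h' : t ∉ E) :
    t ∉ F ∪ E := by
  simp only [mem_union, not_or]; exact ⟨h, h'⟩

set_option maxHeartbeats 1000000 in
lemma place2 {B : Finset (V × V × V)} {ρ γ σ : V → Bool} {q : ℕ} (hB : Base B ρ γ σ q)
    {L F : Finset (V × V × V)} (hL : Lat L) (hF : F ⊆ L) {g H f : ℕ} (hH : HC L B F g H)
    {x y z x1 y1 y2 a : V}
    (h1 : (x, y, a) ∈ L) (h2 : (x, y1, z) ∈ L) (h3 : (x1, y, z) ∈ L) (h4 : (x1, y2, a) ∈ L)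
    (f1 : (x, y, a) ∉ F) (f2 : (x, y1, z) ∉ F) (f3 : (x1, y, z) ∉ F) (f4 : (x1, y2, a) ∉ F)
    (g1 : l1 (Un L B F) x ≤ g) (g2 : l3 (Un L B F) a ≤ g) (g3 : l2 (Un L B F) y1 ≤ g)
    (g4 : l2 (Un L B F) y2 ≤ g)
    (g5 : l3 F z ≤ f) (g6 : l1 F x1 ≤ f)
    (hn : 7 * H + 4 * g + 2 * f + 3 < Fintype.card V)
    (hn' : 6 * (g + 17) + 7 * H + 3 < Fintype.card V)
    (hg : 6 * (g + 26) < q) : Pl 15 L F (x, y, z) := by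
  by_cases hz : z = a
  · subst hz; exact Pl.self hL hF h1 _
  by_cases hy12 : y1 = y2
  · subst hy12; exact (flipF hL hF h1 h2 h3 h4 f1 f2 f3 f4).mono (by omega)
  have hxx : x ≠ x1 := by rintro rfl; exact hz (hL.u3 h3 h1)
  have hyy1 : y ≠ y1 := by rintro rfl; exact hz (hL.u3 h2 h1)
  have hyy2 : y ≠ y2 := by rintro rfl; exact hz (hL.u3 h3 h4)
  obtain ⟨s, c, r, hfn⟩ := hL
  have hfn : Fn L s c r := hfn
  have hL : Lat L := hfn.lat
  have few := ((Few.eq y).or (Few.eq y1)).or (Few.eq y2)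
  have few := few.or hH.2.1
  have few := few.or (hH.1.comp (hfn.ir1 z))
  have few := few.or (hH.2.2.comp (hfn.is2 x))
  have few := few.or (hH.2.2.comp ((hfn.is1 y1).comp (hfn.ir1 z)))
  have few := few.or (hH.2.2.comp (hfn.is2 x1))
  have few := few.or (hH.1.comp (hfn.ir1 a))
  have few := few.or (hH.1.comp ((hfn.ir2 y2).comp (hfn.is2 x1)))
  have few := few.or ((Few.f1 (i2 (f := fun Y => (x, Y, s x Y)) Function.injective_id)
    (Un L B F) x fun _ => rfl).mono g1)
  have few := few.or ((Few.f2 (i1 (f := fun Y => (r Y z, y1, s (r Y z) y1)) (hfn.ir1 z))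
    (Un L B F) y1 fun _ => rfl).mono g3)
  have few := few.or ((Few.f3 (i2 (f := fun Y => (r Y z, Y, z)) Function.injective_id)
    F z fun _ => rfl).mono g5)
  have few := few.or ((Few.f1 (i2 (f := fun Y => (x1, Y, s x1 Y)) Function.injective_id)
    F x1 fun _ => rfl).mono g6)
  have few := few.or ((Few.f3 (i2 (f := fun Y => (r Y a, Y, a)) Function.injective_id)
    (Un L B F) a fun _ => rfl).mono g2)
  have few := few.or ((Few.f2 (i3 (f := fun Y => (r y2 (s x1 Y), y2, s x1 Y)) (hfn.is2 x1))
    (Un L B F) y2 fun _ => rfl).mono g4)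
  obtain ⟨Y, -, hY⟩ := few.exists_good univ (by rw [card_univ]; omega)
  clear few
  simp only [not_or, not_lt, Function.comp] at hY
  obtain ⟨⟨⟨⟨⟨⟨⟨⟨⟨⟨⟨⟨⟨⟨⟨Y1, Y2⟩, Y3⟩, w1⟩, w2⟩, w3⟩, w4⟩, w5⟩, w6⟩, w7⟩, k1⟩, k2⟩, k3⟩, k4⟩, k5⟩, k6⟩ := hY
  have d1 := Cl.of (hfn.ms x Y) k1
  have d2 := Cl.of (hfn.ms (r Y z) y1) k2
  have d3 := hfn.mr Y z
  have d4 := hfn.ms x1 Y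
  have d5 := Cl.of (hfn.mr Y a) k5
  have d6 := Cl.of (hfn.mr y2 (s x1 Y)) k6
  clear k1 k2 k5 k6
  generalize s x Y = z1 at *
  generalize r Y z = x' at *
  generalize s x' y1 = z1' at *
  generalize s x1 Y = b at *
  generalize r Y a = R at *
  generalize r y2 b = R2 at *
  have e1 : z1 ≠ a := by rintro rfl; exact Y1 (hL.u2 d1.1 h1)
  have e2 : z ≠ b := by rintro rfl; exact Y1 (hL.u2 d4 h3)
  have sy : ∀ {a b : V}, a ≠ b → b ≠ a := fun h => h.symm
  obtain ⟨E1, hE1⟩ : ∃ E : Finset (V × V × V), E = {(x, y, a), (x1, y, z), (x1, Y, b),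
    (x1, y2, a), (R, Y, a), (R2, y2, b)} := ⟨_, rfl⟩
  have E1c : E1.card ≤ 6 := by rw [hE1]; exact card_le_six
  have F1 : F ∪ E1 ⊆ L := by
    refine union_subset hF ?_
    rw [hE1]
    intro t; simp only [mem_insert, mem_singleton]
    rintro (rfl | rfl | rfl | rfl | rfl | rfl)
    exacts [h1, h3, d4, h4, d5.1, d6.1]
  have N0 := Near.refl L
  obtain ⟨L1, hL1, n1, m1, q1⟩ := place1 (g := g + 17) (H := H) hB hL F1
    (hH.up N0 E1c (by omega)) h2 d3
    (d1.union d1.1 (by rw [hE1]; simp [Y1, hxx, e1, Y3]))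
    (d2.union d2.1 (by rw [hE1]; simp [sy hyy1, sy Y2, hy12]))
    (nmem_union f2 (by rw [hE1]; simp [sy hyy1, sy Y2, hy12]))
    (nmem_union k3 (by rw [hE1]; simp [Y1, e2, Y3, hz]))
    (Un_l1 N0 E1c g1 (by omega)) (Un_l2 N0 E1c w1 (by omega)) (Un_l3 N0 E1c w3 (by omega))
    (Un_l1 N0 E1c w2 (by omega)) (Un_l2 N0 E1c g3 (by omega)) (Un_l3 N0 E1c w4 (by omega))
    hn' (by omega)
  obtain ⟨E2, hE2⟩ : ∃ E : Finset (V × V × V), E = {(x, Y, z), (x, y, a), (x1, y, z)} := ⟨_, rfl⟩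
  have E2c : E2.card ≤ 3 := by rw [hE2]; exact card_le_three
  have hE1L : E1 ⊆ L1 := subset_union_right.trans q1
  have j : ∀ t ∈ E1, t ∈ L1 := fun t ht => hE1L ht
  simp only [hE1, mem_insert, mem_singleton, forall_eq_or_imp, forall_eq] at j
  obtain ⟨j1, j2, j3, j4, j5, j6⟩ := j
  have F2 : F ∪ E2 ⊆ L1 := by
    refine union_subset (subset_union_left.trans q1) ?_
    rw [hE2]
    intro t; simp only [mem_insert, mem_singleton]
    rintro (rfl | rfl | rfl)
    exacts [m1, j1, j2]
  obtain ⟨L2, hL2, n2, m2, q2⟩ := place1' (g := g + 17) (H := H) hB hL1 F2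
    (hH.up n1 E2c (by omega)) j4 j3
    (d5.union j5 (by rw [hE2]; simp [sy hz, Y1]))
    (d6.union j6 (by rw [hE2]; simp [sy Y3, sy hyy2]))
    (nmem_union f4 (by rw [hE2]; simp [sy hxx, sy hyy2]))
    (nmem_union k4 (by rw [hE2]; simp [sy hxx, Y1]))
    (Un_l3 n1 E2c g2 (by omega)) (Un_l2 n1 E2c w1 (by omega)) (Un_l1 n1 E2c w6 (by omega))
    (Un_l3 n1 E2c w5 (by omega)) (Un_l2 n1 E2c g4 (by omega)) (Un_l1 n1 E2c w7 (by omega))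
    hn' (by omega)
  have hE2L : E2 ⊆ L2 := subset_union_right.trans q2
  have j : ∀ t ∈ E2, t ∈ L2 := fun t ht => hE2L ht
  simp only [hE2, mem_insert, mem_singleton, forall_eq_or_imp, forall_eq] at j
  obtain ⟨j1, j2, j3⟩ := j
  obtain ⟨L3, hL3, n3, m3, q3⟩ := flipF hL2 (subset_union_left.trans q2) j2 j1 j3 m2
    f1 (fun h => Y2 (hL.u2 (hF h) h2)) f3 (fun h => Y3 (hL.u2 (hF h) h4))
  exact ⟨L3, hL3, (n1.trans n2).trans n3, m3, q3⟩

/-- bounds on the lines of `F` -/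
def Fb (F : Finset (V × V × V)) (f : ℕ) : Prop := ∀ x, l1 F x ≤ f ∧ l2 F x ≤ f ∧ l3 F x ≤ f

lemma Fb.union {F E : Finset (V × V × V)} {f e f' : ℕ} (h : Fb F f) (he : E.card ≤ e)
    (hf : f + e ≤ f') : Fb (F ∪ E) f' := by
  intro x
  have := h x
  have := l1_union F E x
  have := l2_union F E x
  have := l3_union F E x
  have := l1_card E x
  have := l2_card E x
  have := l3_card E x
  omega

set_option maxHeartbeats 1000000 in
lemma place3 {B : Finset (V × V × V)} {ρ γ σ : V → Bool} {q : ℕ} (hB : Base B ρ γ σ q)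
    {L F : Finset (V × V × V)} (hL : Lat L) (hF : F ⊆ L) {g H f : ℕ} (hH : HC L B F g H)
    (hFb : Fb F f) {x y z x1 y1 x2 a : V}
    (h1 : (x, y, a) ∈ L) (h2 : (x, y1, z) ∈ L) (h3 : (x1, y, z) ∈ L) (h4 : (x2, y1, a) ∈ L)
    (f1 : (x, y, a) ∉ F) (f2 : (x, y1, z) ∉ F) (f3 : (x1, y, z) ∉ F) (f4 : (x2, y1, a) ∉ F)
    (hn0 : 7 * H + 6 * f + 3 < Fintype.card V)
    (hn : 7 * H + 4 * (g + 33) + 2 * (f + 6) + 3 < Fintype.card V)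
    (hn' : 6 * (g + 50) + 7 * H + 3 < Fintype.card V)
    (hg : 6 * (g + 59) < q) : Pl 31 L F (x, y, z) := by
  by_cases hz : z = a
  · subst hz; exact Pl.self hL hF h1 _
  by_cases hx12 : x1 = x2
  · subst hx12; exact (flipF hL hF h1 h2 h3 h4 f1 f2 f3 f4).mono (by omega)
  have hxx1 : x ≠ x1 := by rintro rfl; exact hz (hL.u3 h3 h1)
  have hyy1 : y ≠ y1 := by rintro rfl; exact hz (hL.u3 h2 h1)
  have hxx2 : x ≠ x2 := by rintro rfl; exact hz (hL.u3 h2 h4)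
  obtain ⟨s, c, r, hfn⟩ := hL
  have hfn : Fn L s c r := hfn
  have hL : Lat L := hfn.lat
  have few := ((Few.eq x).or (Few.eq x1)).or (Few.eq x2)
  have few := few.or hH.1
  have few := few.or (hH.2.2.comp (hfn.is1 y))
  have few := few.or (hH.2.1.comp (hfn.ic1 z))
  have few := few.or (hH.2.1.comp ((hfn.ic2 x1).comp (hfn.is1 y)))
  have few := few.or (hH.2.2.comp (hfn.is1 y1))
  have few := few.or (hH.2.1.comp (hfn.ic1 a))
  have few := few.or (hH.2.1.comp ((hfn.ic2 x2).comp (hfn.is1 y1)))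
  have few := few.or ((Few.f2 (i1 (f := fun X => (X, y, s X y)) Function.injective_id)
    F y fun _ => rfl).mono (hFb y).2.1)
  have few := few.or ((Few.f3 (i1 (f := fun X => (X, c X z, z)) Function.injective_id)
    F z fun _ => rfl).mono (hFb z).2.2)
  have few := few.or ((Few.f1 (i3 (f := fun X => (x1, c x1 (s X y), s X y)) (hfn.is1 y))
    F x1 fun _ => rfl).mono (hFb x1).1)
  have few := few.or ((Few.f2 (i1 (f := fun X => (X, y1, s X y1)) Function.injective_id)
    F y1 fun _ => rfl).mono (hFb y1).2.1)
  have few := few.or ((Few.f3 (i1 (f := fun X => (X, c X a, a)) Function.injective_id)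
    F a fun _ => rfl).mono (hFb a).2.2)
  have few := few.or ((Few.f1 (i3 (f := fun X => (x2, c x2 (s X y1), s X y1)) (hfn.is1 y1))
    F x2 fun _ => rfl).mono (hFb x2).1)
  obtain ⟨X, -, hX⟩ := few.exists_good univ (by rw [card_univ]; omega)
  clear few
  simp only [not_or, not_lt, Function.comp] at hX
  obtain ⟨⟨⟨⟨⟨⟨⟨⟨⟨⟨⟨⟨⟨⟨⟨X1, X2⟩, X3⟩, w1⟩, w2⟩, w3⟩, w4⟩, w5⟩, w6⟩, w7⟩, k1⟩, k2⟩, k3⟩, k4⟩, k5⟩, k6⟩ := hX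
  have d1 := hfn.ms X y
  have d2 := hfn.mc X z
  have d3 := hfn.mc x1 (s X y)
  have d4 := hfn.ms X y1
  have d5 := hfn.mc X a
  have d6 := hfn.mc x2 (s X y1)
  generalize s X y = a' at *
  generalize c X z = c1 at *
  generalize c x1 a' = c2 at *
  generalize s X y1 = a'' at *
  generalize c X a = p1 at *
  generalize c x2 a'' = p2 at *
  have e1 : a' ≠ a := by rintro rfl; exact X1 (hL.u1 d1 h1)
  have e2 : c1 ≠ y1 := by rintro rfl; exact X1 (hL.u1 d2 h2)
  have sy : ∀ {a b : V}, a ≠ b → b ≠ a := fun h => h.symm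
  obtain ⟨E1, hE1⟩ : ∃ E : Finset (V × V × V), E = {(x, y, a), (x, y1, z), (X, y1, a''),
    (X, p1, a), (x2, y1, a), (x2, p2, a'')} := ⟨_, rfl⟩
  have E1c : E1.card ≤ 6 := by rw [hE1]; exact card_le_six
  have F1 : F ∪ E1 ⊆ L := by
    refine union_subset hF ?_
    rw [hE1]
    intro t; simp only [mem_insert, mem_singleton]
    rintro (rfl | rfl | rfl | rfl | rfl | rfl)
    exacts [h1, h2, d4, d5, h4, d6]
  have N0 := Near.refl L
  have Fb1 := hFb.union E1c le_rfl
  obtain ⟨L1, hL1, n1, m1, q1⟩ := place2 (g := g + 33) (H := H) (f := f + 6) hB hL F1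
    (hH.up N0 E1c (by omega)) d1 d2 h3 d3
    (nmem_union k1 (by rw [hE1]; simp [X1, hyy1, e1, X3]))
    (nmem_union k2 (by rw [hE1]; simp [X1, e2, hz, X3]))
    (nmem_union f3 (by rw [hE1]; simp [sy hxx1, sy X2, hx12]))
    (nmem_union k3 (by rw [hE1]; simp [sy hxx1, sy X2, hx12]))
    (Un_l1 N0 E1c w1 (by omega)) (Un_l3 N0 E1c w2 (by omega)) (Un_l2 N0 E1c w3 (by omega))
    (Un_l2 N0 E1c w4 (by omega)) (Fb1 z).2.2 (Fb1 x1).1 hn (by omega) (by omega)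
  obtain ⟨E2, hE2⟩ : ∃ E : Finset (V × V × V), E = {(X, y, z), (x, y, a), (x, y1, z)} := ⟨_, rfl⟩
  have E2c : E2.card ≤ 3 := by rw [hE2]; exact card_le_three
  have hE1L : E1 ⊆ L1 := subset_union_right.trans q1
  have j : ∀ t ∈ E1, t ∈ L1 := fun t ht => hE1L ht
  simp only [hE1, mem_insert, mem_singleton, forall_eq_or_imp, forall_eq] at j
  obtain ⟨j1, j2, j3, j4, j5, j6⟩ := j
  have F2 : F ∪ E2 ⊆ L1 := by
    refine union_subset (subset_union_left.trans q1) ?_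
    rw [hE2]
    intro t; simp only [mem_insert, mem_singleton]
    rintro (rfl | rfl | rfl)
    exacts [m1, j1, j2]
  have Fb2 := hFb.union (f' := f + 6) E2c (by omega)
  obtain ⟨L2, hL2, n2, m2, q2⟩ := place2 (g := g + 33) (H := H) (f := f + 6) hB hL1 F2
    (hH.up n1 E2c (by omega)) j3 j4 j5 j6
    (nmem_union k4 (by rw [hE2]; simp [X1, sy hyy1]))
    (nmem_union k5 (by rw [hE2]; simp [X1, sy hz]))
    (nmem_union f4 (by rw [hE2]; simp [sy hxx2, sy X3]))
    (nmem_union k6 (by rw [hE2]; simp [sy hxx2, sy X3]))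
    (Un_l1 n1 E2c w1 (by omega)) (Un_l3 n1 E2c w5 (by omega)) (Un_l2 n1 E2c w6 (by omega))
    (Un_l2 n1 E2c w7 (by omega)) (Fb2 a).2.2 (Fb2 x2).1 hn (by omega) (by omega)
  have hE2L : E2 ⊆ L2 := subset_union_right.trans q2
  have j : ∀ t ∈ E2, t ∈ L2 := fun t ht => hE2L ht
  simp only [hE2, mem_insert, mem_singleton, forall_eq_or_imp, forall_eq] at j
  obtain ⟨j1, j2, j3⟩ := j
  obtain ⟨L3, hL3, n3, m3, q3⟩ := flipF hL2 (subset_union_left.trans q2) j2 j3 j1 m2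
    f1 f2 (fun h => X2 (hL.u1 (hF h) h3)) (fun h => X3 (hL.u1 (hF h) h4))
  exact ⟨L3, hL3, (n1.trans n2).trans n3, m3, q3⟩

lemma place4 {B : Finset (V × V × V)} {ρ γ σ : V → Bool} {q : ℕ} (hB : Base B ρ γ σ q)
    {L F : Finset (V × V × V)} (hL : Lat L) (hF : F ⊆ L) {g H f : ℕ}
    (hH : ∀ L' F', (L' \ L).card ≤ 124 → F'.card ≤ F.card + 3 → HC L' B F' g H)
    (hFb : Fb F f) {x y z : V}
    (n1 : ∀ w, (x, y, w) ∉ F) (n2 : ∀ w, (x, w, z) ∉ F) (n3 : ∀ w, (w, y, z) ∉ F)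
    (hn0 : 7 * H + 6 * (f + 3) + 3 < Fintype.card V)
    (hn : 7 * H + 4 * (g + 33) + 2 * (f + 9) + 3 < Fintype.card V)
    (hn' : 6 * (g + 50) + 7 * H + 3 < Fintype.card V)
    (hg : 6 * (g + 59) < q) : Pl 62 L F (x, y, z) := by
  obtain ⟨s, c, r, hfn⟩ := hL
  have hfn : Fn L s c r := hfn
  have hL : Lat L := hfn.lat
  obtain ⟨a, h1⟩ := hL.e3 x y
  obtain ⟨y1, h2⟩ := hL.e2 x z
  obtain ⟨x1, h3⟩ := hL.e1 y z
  by_cases hz : z = a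
  · subst hz; exact Pl.self hL hF h1 _
  have hyy1 : y ≠ y1 := by rintro rfl; exact hz (hL.u3 h2 h1)
  have few := ((Few.eq z).or (Few.eq a))
  have few := few.or ((Few.f1 (i3 (f := fun A => (x, c x A, A)) Function.injective_id)
    F x fun _ => rfl).mono (hFb x).1)
  have few := few.or ((Few.f2 (i3 (f := fun A => (r y A, y, A)) Function.injective_id)
    F y fun _ => rfl).mono (hFb y).2.1)
  have few := few.or ((Few.f3 (i2 (f := fun A => (r (c x A) a, c x A, a)) (hfn.ic2 x))
    F a fun _ => rfl).mono (hFb a).2.2)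
  have few := few.or ((Few.f2 (i3 (f := fun A => (r y1 A, y1, A)) Function.injective_id)
    F y1 fun _ => rfl).mono (hFb y1).2.1)
  obtain ⟨A, -, hA⟩ := few.exists_good univ (by rw [card_univ]; omega)
  clear few
  simp only [not_or] at hA
  obtain ⟨⟨⟨⟨⟨A1, A2⟩, k1⟩, k2⟩, k3⟩, k4⟩ := hA
  have d1 := hfn.mc x A
  have d2 := hfn.mr y A
  have d3 := hfn.mr (c x A) a
  have d4 := hfn.mr y1 A
  generalize c x A = p at *
  generalize r y A = o at *
  generalize r p a = u at *
  generalize r y1 A = w at *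
  have e1 : p ≠ y1 := by rintro rfl; exact A1 (hL.u3 d1 h2)
  have sy : ∀ {a b : V}, a ≠ b → b ≠ a := fun h => h.symm
  obtain ⟨E1, hE1⟩ : ∃ E : Finset (V × V × V), E = {(x, y1, z), (x1, y, z), (w, y1, A)} := ⟨_, rfl⟩
  have E1c : E1.card ≤ 3 := by rw [hE1]; exact card_le_three
  have F1 : F ∪ E1 ⊆ L := by
    refine union_subset hF ?_
    rw [hE1]
    intro t; simp only [mem_insert, mem_singleton]
    rintro (rfl | rfl | rfl)
    exacts [h2, h3, d4]
  obtain ⟨L1, hL1, N1, m1, q1⟩ := place3 (g := g) (H := H) (f := f + 3) hB hL F1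
    (hH L (F ∪ E1) (by simp) ((card_union_le _ _).trans (by omega))) (hFb.union E1c le_rfl)
    h1 d1 d2 d3
    (nmem_union (n1 _) (by rw [hE1]; simp [sy hz, hyy1]))
    (nmem_union k1 (by rw [hE1]; simp [A1, e1]))
    (nmem_union k2 (by rw [hE1]; simp [A1, hyy1]))
    (nmem_union k3 (by rw [hE1]; simp [sy hz, sy A2])) hn0 (by omega) hn' hg
  have hE1L : E1 ⊆ L1 := subset_union_right.trans q1
  have j : ∀ t ∈ E1, t ∈ L1 := fun t ht => hE1L ht
  simp only [hE1, mem_insert, mem_singleton, forall_eq_or_imp, forall_eq] at j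
  obtain ⟨j1, j2, j3⟩ := j
  obtain ⟨L2, hL2, N2, m2, q2⟩ := place3 (g := g) (H := H) (f := f + 3) hB hL1
    (subset_union_left.trans q1) (hH L1 F N1.1 (by omega))
    (fun v => by have := hFb v; omega) m1 j1 j2 j3 (n1 _) (n2 _) (n3 _) k4 hn0 (by omega) hn' hg
  exact ⟨L2, hL2, N1.trans N2, m2, q2⟩
/-! ### The induction -/

lemma few_heavy_aux (S : Finset (V × V × V)) (π : V × V × V → V) {h K : ℕ}
    (hS : S.card < (h + 1) * (K + 1)) :
    Few (fun x => h < (S.filter (fun t => π t = x)).card) K := by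
  classical
  unfold Few
  by_contra hc
  push Not at hc
  set T := univ.filter (fun x => h < (S.filter (fun t => π t = x)).card) with hT
  have h1 : S.card = ∑ x, (S.filter (fun t => π t = x)).card :=
    card_eq_sum_card_fiberwise (fun _ _ => by simp)
  have h2 : T.card • (h + 1) ≤ ∑ x ∈ T, (S.filter (fun t => π t = x)).card := by
    apply card_nsmul_le_sum
    intro x hx
    rw [hT, mem_filter] at hx
    exact hx.2
  have h3 : ∑ x ∈ T, (S.filter (fun t => π t = x)).card ≤
      ∑ x, (S.filter (fun t => π t = x)).card :=
    sum_le_sum_of_subset (subset_univ _)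
  rw [smul_eq_mul] at h2
  have hc2 : K + 1 ≤ T.card := by rw [Nat.succ_le_iff]; refine lt_of_lt_of_le hc (card_le_card ?_); intro x; simp [hT]
  have : (h + 1) * (K + 1) ≤ T.card * (h + 1) := by
    rw [mul_comm]; exact Nat.mul_le_mul_right _ hc2
  omega

lemma HC_of {L0 B L F : Finset (V × V × V)} {d m h K : ℕ}
    (hd : Few (fun x => d < l1 (L0 \ B) x) m ∧ Few (fun x => d < l2 (L0 \ B) x) m ∧
      Few (fun x => d < l3 (L0 \ B) x) m)
    (hc : (L \ L0).card + F.card < (h + 1) * (K + 1)) : HC L B F (h + d) (m + K) := by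
  have hsub : Un L B F ⊆ (L0 \ B) ∪ ((L \ L0) ∪ F) := by
    intro t; unfold Un; simp only [mem_sdiff, mem_union]; tauto
  have hS : ((L \ L0) ∪ F).card < (h + 1) * (K + 1) := lt_of_le_of_lt (card_union_le _ _) hc
  refine ⟨(hd.1.or (few_heavy_aux _ (fun t => t.1) hS)).imp ?_,
    (hd.2.1.or (few_heavy_aux _ (fun t => t.2.1) hS)).imp ?_,
    (hd.2.2.or (few_heavy_aux _ (fun t => t.2.2) hS)).imp ?_⟩
  · intro x hx
    have := l1_mono hsub x
    have := l1_union (L0 \ B) ((L \ L0) ∪ F) x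
    have e : l1 ((L \ L0) ∪ F) x = (((L \ L0) ∪ F).filter (fun t => t.1 = x)).card := rfl
    omega
  · intro x hx
    have := l2_mono hsub x
    have := l2_union (L0 \ B) ((L \ L0) ∪ F) x
    have e : l2 ((L \ L0) ∪ F) x = (((L \ L0) ∪ F).filter (fun t => t.2.1 = x)).card := rfl
    omega
  · intro x hx
    have := l3_mono hsub x
    have := l3_union (L0 \ B) ((L \ L0) ∪ F) x
    have e : l3 ((L \ L0) ∪ F) x = (((L \ L0) ∪ F).filter (fun t => t.2.2 = x)).card := rfl
    omega

lemma top {L0 B : Finset (V × V × V)} {ρ γ σ : V → Bool} {q : ℕ} (hB : Base B ρ γ σ q)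
    (hL0 : Lat L0) {d m h K f : ℕ}
    (hd : Few (fun x => d < l1 (L0 \ B) x) m ∧ Few (fun x => d < l2 (L0 \ B) x) m ∧
      Few (fun x => d < l3 (L0 \ B) x) m)
    {P : Finset (V × V × V)} (hP : Fb P f)
    (u3 : ∀ x y z z', (x, y, z) ∈ P → (x, y, z') ∈ P → z = z')
    (u2 : ∀ x y y' z, (x, y, z) ∈ P → (x, y', z) ∈ P → y = y')
    (u1 : ∀ x x' y z, (x, y, z) ∈ P → (x', y, z) ∈ P → x = x')
    (hc : 249 * P.card < (h + 1) * (K + 1))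
    (hn0 : 7 * (m + K) + 6 * (f + 3) + 3 < Fintype.card V)
    (hn : 7 * (m + K) + 4 * (h + d + 33) + 2 * (f + 9) + 3 < Fintype.card V)
    (hn' : 6 * (h + d + 50) + 7 * (m + K) + 3 < Fintype.card V)
    (hg : 6 * (h + d + 59) < q) : ∃ L, Lat L ∧ P ⊆ L := by
  suffices H : ∀ Q : Finset (V × V × V), Q ⊆ P → ∃ L, Lat L ∧ Q ⊆ L ∧
      (L \ L0).card ≤ 248 * Q.card by
    obtain ⟨L, a, b, -⟩ := H P subset_rfl
    exact ⟨L, a, b⟩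
  intro Q
  induction Q using Finset.induction_on with
  | empty => intro _; exact ⟨L0, hL0, by simp, by simp⟩
  | insert t Q ht ih =>
    intro hQ
    have hQP : Q ⊆ P := (subset_insert _ _).trans hQ
    have htP : t ∈ P := hQ (mem_insert_self _ _)
    obtain ⟨L, hL, hQL, hcard⟩ := ih hQP
    have hpc : (insert t Q).card ≤ P.card := card_le_card hQ
    rw [card_insert_of_notMem ht] at hpc ⊢
    obtain ⟨x, y, z⟩ := t
    obtain ⟨L', hL', hN, hm, hsub⟩ := place4 (g := h + d) (H := m + K) (f := f) hB hL hQL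
      (fun L' F' h1 h2 => HC_of hd (by
        have : (L' \ L0).card ≤ (L' \ L).card + (L \ L0).card := by
          refine le_trans (card_le_card ?_) (card_union_le _ _)
          intro t; simp only [mem_sdiff, mem_union]; tauto
        omega))
      (fun v => by
        have := hP v
        have := l1_mono hQP v
        have := l2_mono hQP v
        have := l3_mono hQP v
        omega)
      (x := x) (y := y) (z := z)
      (fun w hw => ht (by rw [u3 _ _ _ _ htP (hQP hw)]; exact hw))
      (fun w hw => ht (by rw [u2 _ _ _ _ htP (hQP hw)]; exact hw))
      (fun w hw => ht (by rw [u1 _ _ _ _ htP (hQP hw)]; exact hw))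
      hn0 hn hn' hg
    refine ⟨L', hL', ?_, ?_⟩
    · intro t' ht'
      rw [mem_insert] at ht'
      rcases ht' with rfl | h'
      · exact hm
      · exact hsub h'
    · have : (L' \ L0).card ≤ (L' \ L).card + (L \ L0).card := by
        refine le_trans (card_le_card ?_) (card_union_le _ _)
        intro t; simp only [mem_sdiff, mem_union]; tauto
      have := hN.1
      omega

/-! ### Dirt of the base square -/

lemma dirt {L0 B : Finset (V × V × V)} (hL : Lat L0) (I : Finset V)
    (hI : ∀ t ∈ L0, t ∉ B → t.1 ∈ I ∨ t.2.1 ∈ I ∨ t.2.2 ∈ I) :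
    Few (fun x => 2 * I.card < l1 (L0 \ B) x) I.card ∧
    Few (fun x => 2 * I.card < l2 (L0 \ B) x) I.card ∧
    Few (fun x => 2 * I.card < l3 (L0 \ B) x) I.card := by
  classical
  have key : ∀ (J : Finset (V × V × V)) (α β : V × V × V → V),
      (∀ t ∈ J, α t ∈ I ∨ β t ∈ I) → Set.InjOn α J → Set.InjOn β J → J.card ≤ 2 * I.card := by
    intro J α β h ha hb
    have h1 : J ⊆ J.filter (fun t => α t ∈ I) ∪ J.filter (fun t => β t ∈ I) := by
      intro t ht; have := h t ht; simp only [mem_union, mem_filter]; tauto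
    have h2 : (J.filter (fun t => α t ∈ I)).card ≤ I.card :=
      card_le_card_of_injOn α (fun t ht => by simp at ht; simpa using ht.2)
        (ha.mono (fun t ht => by simp at ht; exact ht.1))
    have h3 : (J.filter (fun t => β t ∈ I)).card ≤ I.card :=
      card_le_card_of_injOn β (fun t ht => by simp at ht; simpa using ht.2)
        (hb.mono (fun t ht => by simp at ht; exact ht.1))
    have := card_le_card h1
    have := card_union_le (J.filter (fun t => α t ∈ I)) (J.filter (fun t => β t ∈ I))
    omega
  have fewI : Few (fun x => x ∈ I) I.card := by
    unfold Few; apply card_le_card; intro x; simp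
  refine ⟨fewI.imp ?_, fewI.imp ?_, fewI.imp ?_⟩
  · intro x hx
    by_contra hxI
    refine absurd (key ((L0 \ B).filter (fun t => t.1 = x)) (fun t => t.2.1) (fun t => t.2.2)
      ?_ ?_ ?_) (not_le.2 hx)
    · intro t ht
      simp only [mem_filter, mem_sdiff] at ht
      rcases hI t ht.1.1 ht.1.2 with h | h
      · rw [ht.2] at h; exact absurd h hxI
      · exact h
    · rintro ⟨a, b, c⟩ ht ⟨a', b', c'⟩ ht' e
      simp only [coe_filter, mem_sdiff, Set.mem_ofPred_eq] at ht ht' e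
      obtain ⟨⟨h, -⟩, rfl⟩ := ht
      obtain ⟨⟨h', -⟩, rfl⟩ := ht'
      subst e
      rw [hL.u3 h h']
    · rintro ⟨a, b, c⟩ ht ⟨a', b', c'⟩ ht' e
      simp only [coe_filter, mem_sdiff, Set.mem_ofPred_eq] at ht ht' e
      obtain ⟨⟨h, -⟩, rfl⟩ := ht
      obtain ⟨⟨h', -⟩, rfl⟩ := ht'
      subst e
      rw [hL.u2 h h']
  · intro x hx
    by_contra hxI
    refine absurd (key ((L0 \ B).filter (fun t => t.2.1 = x)) (fun t => t.1) (fun t => t.2.2)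
      ?_ ?_ ?_) (not_le.2 hx)
    · intro t ht
      simp only [mem_filter, mem_sdiff] at ht
      rcases hI t ht.1.1 ht.1.2 with h | h | h
      · exact Or.inl h
      · rw [ht.2] at h; exact absurd h hxI
      · exact Or.inr h
    · rintro ⟨a, b, c⟩ ht ⟨a', b', c'⟩ ht' e
      simp only [coe_filter, mem_sdiff, Set.mem_ofPred_eq] at ht ht' e
      obtain ⟨⟨h, -⟩, rfl⟩ := ht
      obtain ⟨⟨h', -⟩, rfl⟩ := ht'
      subst e
      rw [hL.u3 h h']
    · rintro ⟨a, b, c⟩ ht ⟨a', b', c'⟩ ht' e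
      simp only [coe_filter, mem_sdiff, Set.mem_ofPred_eq] at ht ht' e
      obtain ⟨⟨h, -⟩, rfl⟩ := ht
      obtain ⟨⟨h', -⟩, rfl⟩ := ht'
      subst e
      rw [hL.u1 h h']
  · intro x hx
    by_contra hxI
    refine absurd (key ((L0 \ B).filter (fun t => t.2.2 = x)) (fun t => t.1) (fun t => t.2.1)
      ?_ ?_ ?_) (not_le.2 hx)
    · intro t ht
      simp only [mem_filter, mem_sdiff] at ht
      rcases hI t ht.1.1 ht.1.2 with h | h | h
      · exact Or.inl h
      · exact Or.inr h
      · rw [ht.2] at h; exact absurd h hxI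
    · rintro ⟨a, b, c⟩ ht ⟨a', b', c'⟩ ht' e
      simp only [coe_filter, mem_sdiff, Set.mem_ofPred_eq] at ht ht' e
      obtain ⟨⟨h, -⟩, rfl⟩ := ht
      obtain ⟨⟨h', -⟩, rfl⟩ := ht'
      subst e
      rw [hL.u2 h h']
    · rintro ⟨a, b, c⟩ ht ⟨a', b', c'⟩ ht' e
      simp only [coe_filter, mem_sdiff, Set.mem_ofPred_eq] at ht ht' e
      obtain ⟨⟨h, -⟩, rfl⟩ := ht
      obtain ⟨⟨h', -⟩, rfl⟩ := ht'
      subst e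
      rw [hL.u1 h h']

end PLS

namespace PLS
open Finset

/-! ### The base square: prolongation of a group table -/

section prolong
variable {G : Type*} [Group G] [Fintype G] [DecidableEq G] {m : ℕ} [NeZero m]

def Rel (θ η : Equiv.Perm G) (g : Fin m → G) : G ⊕ Fin m → G ⊕ Fin m → G ⊕ Fin m → Prop
  | .inl x, .inl y, .inl z => z = x * y ∧ ∀ j, y ≠ θ x * g j
  | .inl x, .inl y, .inr j => y = θ x * g j
  | .inl x, .inr j, .inl z => z = η x * g j
  | .inl _, .inr _, .inr _ => False
  | .inr j, .inl y, .inl z => ∃ x, y = θ x * g j ∧ z = x * y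
  | .inr _, .inl _, .inr _ => False
  | .inr _, .inr _, .inl _ => False
  | .inr i, .inr j, .inr k => k = i + j

open Classical in
noncomputable def L0 (θ η : Equiv.Perm G) (g : Fin m → G) :
    Finset ((G ⊕ Fin m) × (G ⊕ Fin m) × (G ⊕ Fin m)) :=
  univ.filter (fun t => Rel θ η g t.1 t.2.1 t.2.2)

lemma mem_L0 {θ η : Equiv.Perm G} {g : Fin m → G} {x y z : G ⊕ Fin m} :
    (x, y, z) ∈ L0 θ η g ↔ Rel θ η g x y z := by
  simp [L0]

lemma lat_L0 {θ η : Equiv.Perm G} {g : Fin m → G} (hη : ∀ x, η x = x * θ x)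
    (hg : Function.Injective g) : Lat (L0 θ η g) := by
  apply Lat.mk' <;> simp only [mem_L0]
  · rintro (x | i) (y | j)
    · by_cases h : ∃ j, y = θ x * g j
      · obtain ⟨j, h⟩ := h; exact ⟨.inr j, h⟩
      · push Not at h; exact ⟨.inl (x * y), rfl, h⟩
    · exact ⟨.inl _, rfl⟩
    · exact ⟨.inl _, θ.symm (y * (g i)⁻¹), by simp, rfl⟩
    · exact ⟨.inr _, rfl⟩
  · rintro (x | i) (z | j)
    · by_cases h : ∃ j, x⁻¹ * z = θ x * g j
      · obtain ⟨j, h⟩ := h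
        refine ⟨.inr j, ?_⟩
        simp only [Rel, hη, mul_assoc, ← h]; simp
      · push Not at h; exact ⟨.inl (x⁻¹ * z), by simp, h⟩
    · exact ⟨.inl _, rfl⟩
    · refine ⟨.inl _, η.symm (z * (g i)⁻¹), rfl, ?_⟩
      rw [← mul_assoc, ← hη]; simp
    · exact ⟨.inr (j - i), by simp [Rel]⟩
  · rintro (y | i) (z | j)
    · by_cases h : ∃ j, y = θ (z * y⁻¹) * g j
      · obtain ⟨j, h⟩ := h
        exact ⟨.inr j, z * y⁻¹, h, by simp⟩
      · push Not at h; exact ⟨.inl (z * y⁻¹), by simp, h⟩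
    · exact ⟨.inl (θ.symm (y * (g j)⁻¹)), by simp [Rel]⟩
    · exact ⟨.inl (η.symm (z * (g i)⁻¹)), by simp [Rel]⟩
    · exact ⟨.inr (j - i), by simp [Rel]⟩
  · rintro (x | i) (y | j) (z | k) (z' | k') <;> simp only [Rel]
    · rintro ⟨rfl, -⟩ ⟨rfl, -⟩; rfl
    · rintro ⟨-, h⟩ h'; exact absurd h' (h _)
    · rintro h' ⟨-, h⟩; exact absurd h' (h _)
    · rintro h h'
      rw [h] at h'
      rw [hg (mul_left_cancel h')]
    · rintro rfl rfl; rfl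
    · tauto
    · tauto
    · tauto
    · rintro ⟨x, h, rfl⟩ ⟨x', h', rfl⟩
      rw [h] at h'
      rw [θ.injective (mul_right_cancel h')]
    · tauto
    · tauto
    · tauto
    · tauto
    · tauto
    · tauto
    · rintro rfl rfl; rfl
  · rintro (x | i) (y | j) (y' | j') (z | k) <;> simp only [Rel]
    · rintro ⟨rfl, -⟩ ⟨h, -⟩; rw [mul_left_cancel h]
    · rintro rfl rfl; rfl
    · rintro ⟨rfl, h⟩ h'
      rw [hη, mul_assoc] at h'
      exact absurd (mul_left_cancel h') (h _)
    · tauto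
    · rintro h' ⟨rfl, h⟩ 
      rw [hη, mul_assoc] at h'
      exact absurd (mul_left_cancel h') (h _)
    · tauto
    · rintro h h'
      rw [h] at h'
      rw [hg (mul_left_cancel h')]
    · tauto
    · rintro ⟨x, rfl, rfl⟩ ⟨x', rfl, h⟩
      rw [← mul_assoc, ← mul_assoc, ← hη, ← hη] at h
      rw [η.injective (mul_right_cancel h)]
    · tauto
    · tauto
    · tauto
    · tauto
    · tauto
    · tauto
    · rintro rfl h; rw [add_left_cancel h]
  · rintro (x | i) (x' | i') (y | j) (z | k) <;> simp only [Rel]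
    · rintro ⟨rfl, -⟩ ⟨h, -⟩; rw [mul_right_cancel h]
    · rintro rfl h; rw [θ.injective (mul_right_cancel h)]
    · rintro rfl h; rw [η.injective (mul_right_cancel h)]
    · tauto
    · rintro ⟨rfl, h⟩ ⟨x', h', e⟩
      obtain rfl := mul_right_cancel e
      exact absurd h' (h _)
    · tauto
    · tauto
    · tauto
    · rintro ⟨x', h', e⟩ ⟨rfl, h⟩
      obtain rfl := mul_right_cancel e
      exact absurd h' (h _)
    · tauto
    · tauto
    · tauto
    · rintro ⟨x, h, rfl⟩ ⟨x', h', e⟩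
      obtain rfl := mul_right_cancel e
      rw [h] at h'
      rw [hg (mul_left_cancel h')]
    · tauto
    · tauto
    · rintro rfl h; rw [add_right_cancel h]

noncomputable def B0 (θ η : Equiv.Perm G) (g : Fin m → G) :
    Finset ((G ⊕ Fin m) × (G ⊕ Fin m) × (G ⊕ Fin m)) :=
  (L0 θ η g).filter (fun t => t.1.isLeft ∧ t.2.1.isLeft ∧ t.2.2.isLeft)

lemma mem_B0 {θ η : Equiv.Perm G} {g : Fin m → G} {x y z : G ⊕ Fin m}
    (h : (x, y, z) ∈ B0 θ η g) : ∃ a b, x = .inl a ∧ y = .inl b ∧ z = .inl (a * b) := by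
  simp only [B0, mem_filter, mem_L0] at h
  rcases x with x | x <;> rcases y with y | y <;> rcases z with z | z <;>
    simp [Rel] at h
  exact ⟨x, y, rfl, rfl, by rw [h.1]⟩

def ext (par : G → Bool) : G ⊕ Fin m → Bool
  | .inl x => par x
  | .inr _ => false

lemma bool5 : ∀ x y y1 : Bool, (x ^^ y ^^ (x ^^ y1)) = true → (y1 ^^ y) = true := by decide

lemma base_B0 {θ η : Equiv.Perm G} {g : Fin m → G} {par : G → Bool}
    (hpar : ∀ x y, par (x * y) = (par x ^^ par y)) (hinv : ∀ x, par x = true → x * x = 1)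
    {q : ℕ} (hq : ∀ b, q ≤ (univ.filter (fun x => par x = b)).card) :
    Base (B0 θ η g) (ext par) (ext par) (ext par) q := by
  have p1 : par 1 = false := by have := hpar 1 1; simpa using this
  have pinv : ∀ x, par x⁻¹ = par x := by
    intro x
    have := hpar x x⁻¹
    rw [mul_inv_cancel, p1] at this
    revert this
    cases par x <;> cases par x⁻¹ <;> simp
  have cnt : ∀ b, q ≤ (univ.filter (fun x : G ⊕ Fin m => ext par x = b)).card := by
    intro b
    refine (hq b).trans ?_
    refine card_le_card_of_injOn Sum.inl ?_ Sum.inl_injective.injOn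
    intro x hx
    rw [mem_coe, mem_filter] at hx ⊢
    exact ⟨mem_univ _, hx.2⟩
  constructor
  · intro x y z h
    obtain ⟨a, b, rfl, rfl, rfl⟩ := mem_B0 h
    simp only [ext, hpar]
    cases par a <;> cases par b <;> rfl
  · intro x y z x1 y1 z1 x2 h1 h2 h3 h4 ho
    obtain ⟨a, b, rfl, rfl, rfl⟩ := mem_B0 h1
    obtain ⟨a', b', e1, rfl, rfl⟩ := mem_B0 h2
    obtain rfl := Sum.inl_injective e1
    obtain ⟨u, b2, rfl, e2, e3⟩ := mem_B0 h3
    obtain rfl := Sum.inl_injective e2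
    replace e3 := Sum.inl_injective e3
    obtain ⟨v, b2, rfl, e4, e5⟩ := mem_B0 h4
    obtain rfl := Sum.inl_injective e4
    replace e5 := Sum.inl_injective e5
    simp only [ext, hpar] at ho
    have hh := hinv (b' * b⁻¹) (by rw [hpar, pinv]; exact bool5 _ _ _ ho)
    congr 1
    have i : b' * b⁻¹ = (b' * b⁻¹)⁻¹ := eq_inv_of_mul_eq_one_left hh
    calc v = a * b * b'⁻¹ := by rw [e5]; group
      _ = a * (b' * b⁻¹)⁻¹ := by group
      _ = a * (b' * b⁻¹) := by rw [← i]
      _ = u := by rw [← mul_assoc, e3]; group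
  · intro x y z x1 y1 z1 z2 h1 h2 h3 h4 ho
    obtain ⟨a, b, rfl, rfl, rfl⟩ := mem_B0 h1
    obtain ⟨a', b', e1, rfl, rfl⟩ := mem_B0 h2
    obtain rfl := Sum.inl_injective e1
    obtain ⟨u, b2, rfl, e2, e3⟩ := mem_B0 h3
    obtain rfl := Sum.inl_injective e2
    replace e3 := Sum.inl_injective e3
    obtain ⟨v, b2, e5, e4, rfl⟩ := mem_B0 h4
    obtain rfl := Sum.inl_injective e4
    obtain rfl := Sum.inl_injective e5
    simp only [ext, hpar] at ho
    have hh := hinv (b' * b⁻¹) (by rw [hpar, pinv]; exact bool5 _ _ _ ho)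
    congr 1
    calc u * b' = (u * b) * b⁻¹ * b' := by group
      _ = a * (b' * b⁻¹ * (b' * b⁻¹)) * b := by rw [← e3]; group
      _ = a * b := by rw [hh]; group
  · exact cnt
  · exact cnt

lemma dirt0 {θ η : Equiv.Perm G} {g : Fin m → G} (hη : ∀ x, η x = x * θ x)
    (hg : Function.Injective g) (hm : m ≤ 4) :
    Few (fun x => 8 < l1 (L0 θ η g \ B0 θ η g) x) 4 ∧
    Few (fun x => 8 < l2 (L0 θ η g \ B0 θ η g) x) 4 ∧
    Few (fun x => 8 < l3 (L0 θ η g \ B0 θ η g) x) 4 := by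
  have h := dirt (B := B0 θ η g) (lat_L0 hη hg) (univ.filter (fun x => x.isRight = true)) (by
    rintro ⟨x, y, z⟩ h h'
    simp only [B0, mem_filter, h, true_and] at h'
    simp only [mem_filter, mem_univ, true_and]
    rcases x with x | x <;> rcases y with y | y <;> rcases z with z | z <;> simp_all)
  have hc : (univ.filter (fun x : G ⊕ Fin m => x.isRight = true)).card ≤ 4 := by
    have : (univ.filter (fun x : G ⊕ Fin m => x.isRight = true)) ⊆
        (univ : Finset (Fin m)).image Sum.inr := by
      rintro (x | x) <;> simp
    refine (card_le_card this).trans (card_image_le.trans ?_)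
    simpa using hm
  exact ⟨(h.1.mono hc).imp fun x hx => by omega, (h.2.1.mono hc).imp fun x hx => by omega,
    (h.2.2.mono hc).imp fun x hx => by omega⟩

end prolong

/-! ### A complete mapping of the dihedral group -/

section dih
variable {h : ℕ} [NeZero (2 * h)]
open DihedralGroup

def th : DihedralGroup (2 * h) → DihedralGroup (2 * h)
  | .r i => if i.val < h then .r i else .sr (1 + h - i)
  | .sr i => if i.val < h then .r (h + i) else .sr (1 - i)

lemma Z1 {d : ℤ} (hd : ((2 * d : ℤ) : ZMod (2 * h)) = 0) (hb : |d| < h) : d = 0 := by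
  rw [ZMod.intCast_zmod_eq_zero_iff_dvd] at hd
  push_cast at hd
  have := Int.dvd_of_mul_dvd_mul_left (by norm_num : (2:ℤ) ≠ 0) hd
  exact Int.eq_zero_of_abs_lt_dvd this hb

lemma Z2 {d : ℤ} (hd : ((2 * d + 1 : ℤ) : ZMod (2 * h)) = 0) : False := by
  rw [ZMod.intCast_zmod_eq_zero_iff_dvd] at hd
  push_cast at hd
  have : (2 : ℤ) ∣ 2 * d + 1 := (Dvd.intro _ rfl).trans hd
  omega

lemma Z3 {d : ℤ} (hd : ((d : ℤ) : ZMod (2 * h)) = 0) (hb : |d| < 2 * h) : d = 0 := by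
  rw [ZMod.intCast_zmod_eq_zero_iff_dvd] at hd
  exact Int.eq_zero_of_abs_lt_dvd hd (by push_cast; exact hb)

lemma Zrep (i : ZMod (2 * h)) : ∃ a : ℤ, 0 ≤ a ∧ a < 2 * h ∧ i = (a : ZMod (2 * h)) ∧
    (i.val < h ↔ a < h) := by
  refine ⟨i.val, by positivity, ?_, by simp, Nat.cast_lt.symm⟩
  exact_mod_cast ZMod.val_lt i

lemma th_inj : Function.Injective (th (h := h)) := by
  rintro (i | i) (j | j) e <;> obtain ⟨a, a0, a1, rfl, ha⟩ := Zrep i <;>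
    obtain ⟨b, b0, b1, rfl, hb⟩ := Zrep j <;> simp only [th, ha, hb] at e <;>
    split_ifs at e with k1 k2 k2
  · exact e
  · simp only [DihedralGroup.sr.injEq] at e
    have : b - a = 0 := Z3 (h := h) (by push_cast; linear_combination e) (by rw [abs_lt]; omega)
    rw [show a = b by omega]
  · simp only [DihedralGroup.r.injEq] at e
    have : h + b - a = 0 := Z3 (h := h) (by push_cast; linear_combination -e) (by rw [abs_lt]; omega)
    omega
  · simp only [DihedralGroup.sr.injEq] at e
    have : h + b - a = 0 := Z3 (h := h) (by push_cast; linear_combination e) (by rw [abs_lt]; omega)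
    omega
  · simp only [DihedralGroup.r.injEq] at e
    have : h + a - b = 0 := Z3 (h := h) (by push_cast; linear_combination e) (by rw [abs_lt]; omega)
    omega
  · simp only [DihedralGroup.sr.injEq] at e
    have : h + a - b = 0 := Z3 (h := h) (by push_cast; linear_combination -e) (by rw [abs_lt]; omega)
    omega
  · simp only [DihedralGroup.r.injEq] at e
    have : a - b = 0 := Z3 (h := h) (by push_cast; linear_combination e) (by rw [abs_lt]; omega)
    rw [show a = b by omega]
  · simp only [DihedralGroup.sr.injEq] at e
    have : b - a = 0 := Z3 (h := h) (by push_cast; linear_combination e) (by rw [abs_lt]; omega)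
    rw [show a = b by omega]

lemma et_inj : Function.Injective (fun x => x * th (h := h) x) := by
  rintro (i | i) (j | j) e <;> obtain ⟨a, a0, a1, rfl, ha⟩ := Zrep i <;>
    obtain ⟨b, b0, b1, rfl, hb⟩ := Zrep j <;> simp only [th, ha, hb] at e <;>
    split_ifs at e with k1 k2 k2 <;>
    simp only [DihedralGroup.r_mul_r, DihedralGroup.r_mul_sr, DihedralGroup.sr_mul_r,
      DihedralGroup.sr_mul_sr, DihedralGroup.r.injEq, DihedralGroup.sr.injEq, reduceCtorEq] at e
  · have : a - b = 0 := Z1 (h := h) (by push_cast; linear_combination e) (by rw [abs_lt]; omega)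
    rw [show a = b by omega]
  · have : a - b = 0 := Z1 (h := h) (by push_cast; linear_combination -e) (by rw [abs_lt]; omega)
    rw [show a = b by omega]
  · exact (Z2 (h := h) (d := a + b - 1) (by push_cast; linear_combination e)).elim
  · exact (Z2 (h := h) (d := - a - b) (by push_cast; linear_combination e)).elim
  · exact (Z2 (h := h) (d := - a - b) (by push_cast; linear_combination -e)).elim
  · exact (Z2 (h := h) (d := - a - b) (by push_cast; linear_combination e)).elim
  · have : a - b = 0 := Z1 (h := h) (by push_cast; linear_combination e) (by rw [abs_lt]; omega)
    rw [show a = b by omega]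
  · have : a - b = 0 := Z1 (h := h) (by push_cast; linear_combination -e) (by rw [abs_lt]; omega)
    rw [show a = b by omega]

def dpar : DihedralGroup (2 * h) → Bool
  | .r _ => false
  | .sr _ => true

lemma dpar_mul (x y : DihedralGroup (2 * h)) : dpar (x * y) = (dpar x ^^ dpar y) := by
  rcases x with i | i <;> rcases y with j | j <;> simp [dpar]

lemma dpar_inv (x : DihedralGroup (2 * h)) (hx : dpar x = true) : x * x = 1 := by
  rcases x with i | i
  · simp [dpar] at hx
  · simp

lemma dpar_card (b : Bool) :
    2 * h ≤ (univ.filter (fun x : DihedralGroup (2 * h) => dpar x = b)).card := by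
  have hc : (univ : Finset (ZMod (2 * h))).card = 2 * h := by rw [card_univ, ZMod.card]
  cases b
  · conv_lhs => rw [← hc]
    refine card_le_card_of_injOn DihedralGroup.r ?_ ?_
    · intro x _
      rw [mem_coe, mem_filter]
      exact ⟨mem_univ _, rfl⟩
    · intro x _ y _ e; simpa using e
  · conv_lhs => rw [← hc]
    refine card_le_card_of_injOn DihedralGroup.sr ?_ ?_
    · intro x _
      rw [mem_coe, mem_filter]
      exact ⟨mem_univ _, rfl⟩
    · intro x _ y _ e; simpa using e

end dih

end PLS

namespace PLS

lemma inj_of_le {α β : Type*} [DecidableEq β] {S : Finset α} {T : Finset β} (f : α → β)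
    (h : ∀ t ∈ S, f t ∈ T) (hf : ∀ t ∈ S, ∀ t' ∈ S, f t = f t' → t = t') : S.card ≤ T.card :=
  Finset.card_le_card_of_injOn f h (fun t ht t' ht' => hf t ht t' ht')

set_option maxHeartbeats 1000000 in
lemma large (n : ℕ) (hn : 1325 ≤ n) (P : Fin n → Fin n → Option (Fin n))
    (hP : IsPartialLatinSquare P) (hdense : IsEpsDense (1 / 13) P)
    (hfill : (filledCells P : ℝ) ≤ (5.7 * 10 ^ (-7 : ℤ)) * n ^ 2) :
    ∃ L : Fin n → Fin n → Fin n, IsLatinSquare L ∧ Completes L P := by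
  classical
  obtain ⟨k, m, hk, hm0, hm4, hk0⟩ : ∃ k m : ℕ, n = 4 * k + m ∧ 0 < m ∧ m ≤ 4 ∧ 5 ≤ k :=
    ⟨(n - 1) / 4, n - 4 * ((n - 1) / 4), by omega, by omega, by omega, by omega⟩
  haveI : NeZero (2 * k) := ⟨by omega⟩
  haveI : NeZero m := ⟨by omega⟩
  let V := DihedralGroup (2 * k) ⊕ Fin m
  have hcard : Fintype.card V = n := by
    simp only [V, Fintype.card_sum, DihedralGroup.card, Fintype.card_fin]; omega
  let e : Fin n ≃ V := (finCongr hcard.symm).trans (Fintype.equivFin V).symm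
  let θ : Equiv.Perm (DihedralGroup (2 * k)) :=
    Equiv.ofBijective th (Finite.injective_iff_bijective.1 th_inj)
  let η : Equiv.Perm (DihedralGroup (2 * k)) :=
    Equiv.ofBijective _ (Finite.injective_iff_bijective.1 (et_inj (h := k)))
  have hη : ∀ x, η x = x * θ x := fun x => rfl
  obtain ⟨g⟩ : Nonempty (Fin m ↪ DihedralGroup (2 * k)) := by
    rw [Function.Embedding.nonempty_iff_card_le]
    simp only [DihedralGroup.card, Fintype.card_fin]; omega
  have hL0 := lat_L0 hη g.injective
  have hB : Base (B0 θ η g) _ _ _ (2 * k) := base_B0 dpar_mul dpar_inv dpar_card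
  have hD := dirt0 hη g.injective hm4
  let Q : Finset (V × V × V) := Finset.univ.filter
    (fun t => P (e.symm t.1) (e.symm t.2.1) = some (e.symm t.2.2))
  have hQ : ∀ x y z, (x, y, z) ∈ Q ↔ P (e.symm x) (e.symm y) = some (e.symm z) := by
    intro x y z; simp [Q]
  have u3 : ∀ x y z z', (x, y, z) ∈ Q → (x, y, z') ∈ Q → z = z' := by
    intro x y z z' h h'
    rw [hQ] at h h'
    rw [h] at h'
    exact e.symm.injective (Option.some_injective _ h')
  have u2 : ∀ x y y' z, (x, y, z) ∈ Q → (x, y', z) ∈ Q → y = y' := by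
    intro x y y' z h h'
    rw [hQ] at h h'
    exact e.symm.injective (hP.1 _ _ _ _ h h')
  have u1 : ∀ x x' y z, (x, y, z) ∈ Q → (x', y, z) ∈ Q → x = x' := by
    intro x x' y z h h'
    rw [hQ] at h h'
    exact e.symm.injective (hP.2 _ _ _ _ h h')
  have hfl : ∀ a : ℕ, (a : ℝ) ≤ 1 / 13 * n → a ≤ n / 13 := by
    intro a ha
    rw [Nat.le_div_iff_mul_le (by norm_num)]
    have : (a : ℝ) * 13 ≤ n := by linarith
    exact_mod_cast this
  have hFb : Fb Q (n / 13) := by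
    intro v
    refine ⟨le_trans ?_ (hfl _ (hdense.1 (e.symm v))), le_trans ?_ (hfl _ (hdense.2.1 (e.symm v))),
      le_trans ?_ (hfl _ (hdense.2.2 (e.symm v)))⟩
    · refine inj_of_le (fun t => e.symm t.2.1) ?_ ?_
      · rintro ⟨x, y, z⟩ ht
        rw [Finset.mem_filter, hQ] at ht
        obtain ⟨h, rfl⟩ := ht
        rw [Finset.mem_filter]
        exact ⟨Finset.mem_univ _, by simp only [h, Option.isSome_some]⟩
      · rintro ⟨x, y, z⟩ ht ⟨x', y', z'⟩ ht' ee
        rw [Finset.mem_filter] at ht ht'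
        obtain ⟨h, rfl⟩ := ht
        obtain ⟨h', e1⟩ := ht'
        simp only at e1
        subst e1
        obtain rfl := e.symm.injective ee
        rw [u3 _ _ _ _ h h']
    · refine inj_of_le (fun t => e.symm t.1) ?_ ?_
      · rintro ⟨x, y, z⟩ ht
        rw [Finset.mem_filter, hQ] at ht
        obtain ⟨h, rfl⟩ := ht
        rw [Finset.mem_filter]
        exact ⟨Finset.mem_univ _, by simp only [h, Option.isSome_some]⟩
      · rintro ⟨x, y, z⟩ ht ⟨x', y', z'⟩ ht' ee
        rw [Finset.mem_filter] at ht ht'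
        obtain ⟨h, rfl⟩ := ht
        obtain ⟨h', e1⟩ := ht'
        simp only at e1
        subst e1
        obtain rfl := e.symm.injective ee
        rw [u3 _ _ _ _ h h']
    · refine inj_of_le (fun t => (e.symm t.1, e.symm t.2.1)) ?_ ?_
      · rintro ⟨x, y, z⟩ ht
        rw [Finset.mem_filter, hQ] at ht
        obtain ⟨h, rfl⟩ := ht
        rw [Finset.mem_filter]
        exact ⟨Finset.mem_univ _, h⟩
      · rintro ⟨x, y, z⟩ ht ⟨x', y', z'⟩ ht' ee
        rw [Finset.mem_filter] at ht ht'
        simp only [Prod.mk.injEq] at ee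
        obtain rfl := e.symm.injective ee.1
        obtain rfl := e.symm.injective ee.2
        rw [u3 _ _ _ _ ht.1 ht'.1]
  have hQc : Q.card ≤ filledCells P := by
    refine inj_of_le (fun t => (e.symm t.1, e.symm t.2.1)) ?_ ?_
    · rintro ⟨x, y, z⟩ ht
      rw [hQ] at ht
      rw [Finset.mem_filter]
      exact ⟨Finset.mem_univ _, by simp only [ht]; simp⟩
    · rintro ⟨x, y, z⟩ ht ⟨x', y', z'⟩ ht' ee
      simp only [Prod.mk.injEq] at ee
      obtain rfl := e.symm.injective ee.1
      obtain rfl := e.symm.injective ee.2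
      rw [u3 _ _ _ _ ht ht']
  have hnum : 249 * Q.card < (n / 60 + 1) * (n / 110 + 1) := by
    have h1 : 10 ^ 8 * Q.card ≤ 57 * n ^ 2 := by
      have : (Q.card : ℝ) ≤ (5.7 * 10 ^ (-7 : ℤ)) * n ^ 2 :=
        le_trans (by exact_mod_cast hQc) hfill
      have h3 : (10 : ℝ) ^ 8 * Q.card ≤ 57 * n ^ 2 := by
        have e7 : (10 : ℝ) ^ (-7 : ℤ) = 1 / 10 ^ 7 := by norm_num
        rw [e7] at this
        linarith
      exact_mod_cast h3
    have h2 : n < 60 * (n / 60 + 1) := by omega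
    have h3 : n < 110 * (n / 110 + 1) := by omega
    have h4 : n * n < (60 * (n / 60 + 1)) * (110 * (n / 110 + 1)) := Nat.mul_lt_mul'' h2 h3
    generalize n / 60 + 1 = A at *
    generalize n / 110 + 1 = B at *
    nlinarith
  obtain ⟨L, hL, hQL⟩ := top (h := n / 60) (K := n / 110) (f := n / 13) hB hL0 hD hFb u3 u2 u1 hnum
    (by rw [hcard]; omega) (by rw [hcard]; omega) (by rw [hcard]; omega) (by omega)
  obtain ⟨s, c, r, hs⟩ := hL
  have hfn : Fn L s c r := hs
  refine ⟨fun i j => e.symm (s (e i) (e j)), ⟨fun i => ?_, fun j => ?_⟩, ?_⟩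
  · exact Finite.injective_iff_bijective.1
      (e.symm.injective.comp ((hfn.is2 (e i)).comp e.injective))
  · exact Finite.injective_iff_bijective.1
      (e.symm.injective.comp ((hfn.is1 (e j)).comp e.injective))
  · intro i j v hv
    have : (e i, e j, e v) ∈ L := hQL (by rw [hQ]; simpa using hv)
    rw [(hs _ _ _).1] at this
    simp only [this, Equiv.symm_apply_apply]

lemma small (n : ℕ) (hn : n < 1325) (P : Fin n → Fin n → Option (Fin n))
    (hfill : (filledCells P : ℝ) ≤ (5.7 * 10 ^ (-7 : ℤ)) * n ^ 2) :
    ∃ L : Fin n → Fin n → Fin n, IsLatinSquare L ∧ Completes L P := by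
  have h0 : filledCells P = 0 := by
    have hn' : (n : ℝ) ≤ 1324 := by exact_mod_cast Nat.le_of_lt_succ hn
    have hn0 : (0 : ℝ) ≤ n := by positivity
    have e7 : (10 : ℝ) ^ (-7 : ℤ) = 1 / 10 ^ 7 := by norm_num
    rw [e7] at hfill
    have : (filledCells P : ℝ) < 1 := by nlinarith
    have : filledCells P < 1 := by exact_mod_cast this
    omega
  have hP : ∀ i j, P i j = none := by
    intro i j
    unfold filledCells at h0
    rw [Finset.card_eq_zero, Finset.filter_eq_empty_iff] at h0
    simpa using h0 (Finset.mem_univ (i, j))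
  rcases Nat.eq_zero_or_pos n with rfl | hpos
  · exact ⟨fun i => i.elim0, ⟨fun i => i.elim0, fun i => i.elim0⟩, fun i => i.elim0⟩
  · haveI : NeZero n := ⟨by omega⟩
    refine ⟨fun i j => i + j, ⟨fun i => ?_, fun j => ?_⟩, ?_⟩
    · exact Finite.injective_iff_bijective.1 (add_right_injective i)
    · exact Finite.injective_iff_bijective.1 (add_left_injective j)
    · intro i j s h
      rw [hP] at h
      cases h

end PLS

/-- Every `(1/13)`-dense partial latin square of order `n` with at most
`5.7 · 10⁻⁷ · n²` filled cells is completable. -/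
theorem thirteenth_dense_partial_latin_square_completable
    (n : ℕ) (P : Fin n → Fin n → Option (Fin n))
    (hP : IsPartialLatinSquare P) (hdense : IsEpsDense (1 / 13) P)
    (hfill : (filledCells P : ℝ) ≤ (5.7 * 10 ^ (-7 : ℤ)) * n ^ 2) :
    ∃ L : Fin n → Fin n → Fin n, IsLatinSquare L ∧ Completes L P := by
  rcases Nat.lt_or_ge n 1325 with hn | hn
  · exact PLS.small n hn P hfill
  · exact PLS.large n hn P hP hdense hfill
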